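/- arXiv:2205.05384 — 2 statements merged into one kernel-verified Lean document; each statement's English description precedes it below -/
import Mathlib

section
/- Let (E,C) be a locally finite bipartite separated graph with s(E^1)=E^{0,0} and r(E^1)=E^{0,1}, and identify LV(E,C) with the corner V L(E,C) V of L(E,C) via p_v↦v and τ(x,y)↦xy*. Let U' be the multiplicative *-semigroup of L(E,C) generated by E^1 and let J' be the two-sided ideal of L(E,C) generated by all commutators [uu*, u'u'*] with u,u'∈U'. Let U be the multiplicative *-semigroup of LV(E,C) generated by {τ(x,y)=xy* : x,y∈E^1, r(x)=r(y)} and let J be the two-sided ideal of LV(E,C) generated by all commutators [uu*, u'u'*] with u,u'∈U. Then J' ∩ V L(E,C) V = J; consequently the canonical surjection from the universal tame *-algebra LV^{ab}(E,C)=LV(E,C)/J onto the corner of L^{ab}(E,C)=L(E,C)/J' spanned by elements u a w with u,w∈E^{0,0} is a *-isomorphism. -/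
open Sum

noncomputable section
open scoped Classical

/-- A bipartite separated graph. -/
structure BipSepGraph where
  V0 : Type
  V1 : Type
  E : Type
  s : E → V0
  r : E → V1
  c : E → E → Prop
  c_equiv : Equivalence c
  c_src : ∀ {e f}, c e f → s e = s f
  rowFinite : ∀ v : V0, {e | s e = v}.Finite

namespace BipSepGraph

lemma classSet_finite (G : BipSepGraph) (e : G.E) : {f | G.c e f}.Finite :=
  (G.rowFinite (G.s e)).subset (fun _ hf => (G.c_src hf).symm)

/-- The finite set of edges in the same member of the partition `C` as `e`. -/
def classFinset (G : BipSepGraph) (e : G.E) : Finset G.E :=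
  (G.classSet_finite e).toFinset

end BipSepGraph

variable (K : Type) [Field K] [StarRing K]

/-- A representation of the relations defining the Leavitt path algebra `L(E,C)` of a
separated graph in a (nonunital) `*`-algebra. -/
structure LPARep (G : BipSepGraph) (A : Type) [NonUnitalRing A] [Module K A]
    [SMulCommClass K A A] [IsScalarTower K A A] [StarRing A] [StarModule K A] where
  pv : G.V0 ⊕ G.V1 → A
  ge : G.E → A
  pv_star : ∀ u, star (pv u) = pv u
  pv_idem : ∀ u, pv u * pv u = pv u
  pv_orth : ∀ u u', u ≠ u' → pv u * pv u' = 0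
  src_mul : ∀ e, pv (inl (G.s e)) * ge e = ge e
  mul_rng : ∀ e, ge e * pv (inr (G.r e)) = ge e
  sck1 : ∀ e f, G.c e f → star (ge e) * ge f = if e = f then pv (inr (G.r e)) else 0
  sck2 : ∀ e, ∑ f ∈ G.classFinset e, ge f * star (ge f) = pv (inl (G.s e))

/-- `L` (with the representation `ρ`) *is* the Leavitt path algebra `L(E,C)`:
it satisfies the universal property among all `*`-algebras over `K`. -/
def IsLPA (G : BipSepGraph) (L : Type) [NonUnitalRing L] [Module K L]
    [SMulCommClass K L L] [IsScalarTower K L L] [StarRing L] [StarModule K L]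
    (ρ : LPARep K G L) : Prop :=
  ∀ (A : Type) [NonUnitalRing A] [Module K A] [SMulCommClass K A A] [IsScalarTower K A A]
    [StarRing A] [StarModule K A] (σ : LPARep K G A),
    ∃! φ : L →⋆ₙₐ[K] A, (∀ u, φ (ρ.pv u) = σ.pv u) ∧ (∀ e, φ (ρ.ge e) = σ.ge e)

/-- A representation of the relations defining the upper Leavitt path algebra `LV(E,C)`
of a bipartite separated graph.  The generator `τ(e,f)` (for `r e = r f`) is `tau e f`;
values of `tau` at pairs with `r e ≠ r f` are irrelevant. -/
structure LVRep (G : BipSepGraph) (A : Type) [NonUnitalRing A] [Module K A]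
    [SMulCommClass K A A] [IsScalarTower K A A] [StarRing A] [StarModule K A] where
  pv : G.V0 → A
  tau : G.E → G.E → A
  pv_star : ∀ v, star (pv v) = pv v
  pv_idem : ∀ v, pv v * pv v = pv v
  pv_orth : ∀ v v', v ≠ v' → pv v * pv v' = 0
  tau_star : ∀ e f, G.r e = G.r f → star (tau e f) = tau f e
  tau_right : ∀ e f, G.r e = G.r f → tau e f * pv (G.s f) = tau e f
  tau_left : ∀ e f, G.r e = G.r f → pv (G.s e) * tau e f = tau e f
  sck1 : ∀ e f g h, G.r e = G.r f → G.r g = G.r h → G.c f g →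
    tau e f * tau g h = if f = g then tau e h else 0
  sck2 : ∀ g : G.E, ∑ e ∈ G.classFinset g, tau e e = pv (G.s g)

/-- `L` (with the representation `ρ`) *is* the upper Leavitt path algebra `LV(E,C)`. -/
def IsLV (G : BipSepGraph) (L : Type) [NonUnitalRing L] [Module K L]
    [SMulCommClass K L L] [IsScalarTower K L L] [StarRing L] [StarModule K L]
    (ρ : LVRep K G L) : Prop :=
  ∀ (A : Type) [NonUnitalRing A] [Module K A] [SMulCommClass K A A] [IsScalarTower K A A]
    [StarRing A] [StarModule K A] (σ : LVRep K G A),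
    ∃! φ : L →⋆ₙₐ[K] A, (∀ v, φ (ρ.pv v) = σ.pv v) ∧
      (∀ e f, G.r e = G.r f → φ (ρ.tau e f) = σ.tau e f)

/-- A representation of the relations defining the lower Leavitt path algebra `LW(E,C)`
of a bipartite separated graph.  The generator `ρ(e,f)` (for `s e = s f`, `X_e ≠ X_f`)
is `rho e f`; the values of `rho` at other pairs are irrelevant. -/
structure LWRep (G : BipSepGraph) (A : Type) [NonUnitalRing A] [Module K A]
    [SMulCommClass K A A] [IsScalarTower K A A] [StarRing A] [StarModule K A] where
  pw : G.V1 → A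
  rho : G.E → G.E → A
  pw_star : ∀ w, star (pw w) = pw w
  pw_idem : ∀ w, pw w * pw w = pw w
  pw_orth : ∀ w w', w ≠ w' → pw w * pw w' = 0
  rho_star : ∀ e f, G.s e = G.s f → ¬ G.c e f → star (rho e f) = rho f e
  rho_right : ∀ e f, G.s e = G.s f → ¬ G.c e f → rho e f * pw (G.r f) = rho e f
  rho_left : ∀ e f, G.s e = G.s f → ¬ G.c e f → pw (G.r e) * rho e f = rho e f
  sck1 : ∀ e h g, G.s e = G.s h → G.s g = G.s e → ¬ G.c g e → ¬ G.c g h →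
    (∑ f ∈ G.classFinset g, rho e f * rho f h) =
      if G.c e h then (if e = h then pw (G.r e) else 0) else rho e h

/-- `L` (with the representation `ρ`) *is* the lower Leavitt path algebra `LW(E,C)`. -/
def IsLW (G : BipSepGraph) (L : Type) [NonUnitalRing L] [Module K L]
    [SMulCommClass K L L] [IsScalarTower K L L] [StarRing L] [StarModule K L]
    (ρ : LWRep K G L) : Prop :=
  ∀ (A : Type) [NonUnitalRing A] [Module K A] [SMulCommClass K A A] [IsScalarTower K A A]
    [StarRing A] [StarModule K A] (σ : LWRep K G A),
    ∃! φ : L →⋆ₙₐ[K] A, (∀ w, φ (ρ.pw w) = σ.pw w) ∧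
      (∀ e f, G.s e = G.s f → ¬ G.c e f → φ (ρ.rho e f) = σ.rho e f)

/-- The multiplicative `*`-subsemigroup generated by a set `S` in a `*`-algebra. -/
inductive StarSemigroup {A : Type} [Mul A] [Star A] (S : Set A) : A → Prop
  | base {x} : x ∈ S → StarSemigroup S x
  | star_mem {x} : StarSemigroup S x → StarSemigroup S (star x)
  | mul_mem {x y} : StarSemigroup S x → StarSemigroup S y → StarSemigroup S (x * y)

/-- A set `S` of partial isometries is tame if the projections `e(u) = u u*`, for `u` in
the `*`-subsemigroup generated by `S`, commute with each other. -/
def IsTameSet {A : Type} [Mul A] [Star A] (S : Set A) : Prop :=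
  ∀ u u', StarSemigroup S u → StarSemigroup S u' →
    (u * star u) * (u' * star u') = (u' * star u') * (u * star u)

section TameBip

variable {G : BipSepGraph}

/-- The canonical generating set `E¹` of partial isometries of `L(E,C)`. -/
def LPARep.genSet {A : Type} [NonUnitalRing A] [Module K A]
    [SMulCommClass K A A] [IsScalarTower K A A] [StarRing A] [StarModule K A]
    (ρ : LPARep K G A) : Set A := Set.range ρ.ge

/-- Tameness of the canonical generating set of partial isometries of `L(E,C)`. -/
def LPARep.Tame {A : Type} [NonUnitalRing A] [Module K A]
    [SMulCommClass K A A] [IsScalarTower K A A] [StarRing A] [StarModule K A]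
    (ρ : LPARep K G A) : Prop := IsTameSet (ρ.genSet K)

/-- The canonical generating set `{τ(x,y) : r(x) = r(y)}` of partial isometries of
`LV(E,C)`. -/
def LVRep.genSet {A : Type} [NonUnitalRing A] [Module K A]
    [SMulCommClass K A A] [IsScalarTower K A A] [StarRing A] [StarModule K A]
    (σ : LVRep K G A) : Set A := {x | ∃ e f, G.r e = G.r f ∧ x = σ.tau e f}

/-- Tameness of the canonical generating set of partial isometries of `LV(E,C)`. -/
def LVRep.Tame {A : Type} [NonUnitalRing A] [Module K A]
    [SMulCommClass K A A] [IsScalarTower K A A] [StarRing A] [StarModule K A]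
    (σ : LVRep K G A) : Prop := IsTameSet (σ.genSet K)

end TameBip

/-- `L` (with the tame representation `ρ`) *is* the abelianized Leavitt path algebra
`L^{ab}(E,C)`: the universal tame `*`-algebra on the canonical generators of `L(E,C)`. -/
def IsLPAab (G : BipSepGraph) (L : Type) [NonUnitalRing L] [Module K L]
    [SMulCommClass K L L] [IsScalarTower K L L] [StarRing L] [StarModule K L]
    (ρ : LPARep K G L) : Prop :=
  ρ.Tame K ∧
  ∀ (A : Type) [NonUnitalRing A] [Module K A] [SMulCommClass K A A] [IsScalarTower K A A]
    [StarRing A] [StarModule K A] (σ : LPARep K G A), σ.Tame K →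
    ∃! φ : L →⋆ₙₐ[K] A, (∀ u, φ (ρ.pv u) = σ.pv u) ∧ (∀ e, φ (ρ.ge e) = σ.ge e)

/-- `L` (with the tame representation `σ`) *is* `LV^{ab}(E,C)`: the universal tame
`*`-algebra on the canonical generators of `LV(E,C)`. -/
def IsLVab (G : BipSepGraph) (L : Type) [NonUnitalRing L] [Module K L]
    [SMulCommClass K L L] [IsScalarTower K L L] [StarRing L] [StarModule K L]
    (σ : LVRep K G L) : Prop :=
  σ.Tame K ∧
  ∀ (A : Type) [NonUnitalRing A] [Module K A] [SMulCommClass K A A] [IsScalarTower K A A]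
    [StarRing A] [StarModule K A] (σ' : LVRep K G A), σ'.Tame K →
    ∃! φ : L →⋆ₙₐ[K] A, (∀ v, φ (σ.pv v) = σ'.pv v) ∧
      (∀ e f, G.r e = G.r f → φ (σ.tau e f) = σ'.tau e f)

section StarAlgebra

variable {K}

theorem StarSemigroup.map {A B : Type} [Mul A] [Star A] [Mul B] [Star B] {S : Set A} {T : Set B}
    (f : A → B) (hmul : ∀ x y, f (x * y) = f x * f y) (hstar : ∀ x, f (star x) = star (f x))
    (hf : ∀ x ∈ S, StarSemigroup T (f x)) {u : A} (hu : StarSemigroup S u) :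
    StarSemigroup T (f u) := by
  induction hu with
  | base h => exact hf _ h
  | star_mem _ ih => rw [hstar]; exact ih.star_mem
  | mul_mem _ _ ih₁ ih₂ => rw [hmul]; exact ih₁.mul_mem ih₂

theorem StarSemigroup.exists_lift {A B : Type} [Mul A] [Star A] [Mul B] [Star B] {S : Set A}
    {T : Set B} (f : A → B) (hmul : ∀ x y, f (x * y) = f x * f y)
    (hstar : ∀ x, f (star x) = star (f x)) (hf : ∀ y ∈ T, ∃ x ∈ S, f x = y) {u : B}
    (hu : StarSemigroup T u) : ∃ x, StarSemigroup S x ∧ f x = u := by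
  induction hu with
  | base h =>
    obtain ⟨x, hx, rfl⟩ := hf _ h
    exact ⟨x, .base hx, rfl⟩
  | star_mem _ ih =>
    obtain ⟨x, hx, rfl⟩ := ih
    exact ⟨star x, hx.star_mem, hstar x⟩
  | mul_mem _ _ ih₁ ih₂ =>
    obtain ⟨x, hx, rfl⟩ := ih₁
    obtain ⟨y, hy, rfl⟩ := ih₂
    exact ⟨x * y, hx.mul_mem hy, hmul x y⟩

/-- The commutator `[uu*, u'u'*]`. -/
def projComm {A : Type} [NonUnitalRing A] [StarRing A] (u u' : A) : A :=
  (u * star u) * (u' * star u') - (u' * star u') * (u * star u)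

/-- The ideal generated by the commutators `[uu*, u'u'*]`, for `u, u'` in the `*`-semigroup
generated by `S`. -/
def tameIdeal {A : Type} [NonUnitalRing A] [StarRing A] (S : Set A) : TwoSidedIdeal A :=
  TwoSidedIdeal.span {z : A | ∃ u u', StarSemigroup S u ∧ StarSemigroup S u' ∧
    z = (u * star u) * (u' * star u') - (u' * star u') * (u * star u)}

section

variable {A : Type} [NonUnitalRing A] [StarRing A] {S : Set A}

theorem projComm_mem_tameIdeal {u u' : A} (hu : StarSemigroup S u) (hu' : StarSemigroup S u') :
    projComm u u' ∈ tameIdeal S :=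
  TwoSidedIdeal.subset_span ⟨u, u', hu, hu', rfl⟩

theorem tameIdeal_le {I : TwoSidedIdeal A}
    (h : ∀ u u', StarSemigroup S u → StarSemigroup S u' → projComm u u' ∈ I) :
    tameIdeal S ≤ I := by
  refine TwoSidedIdeal.span_le.2 ?_
  rintro _ ⟨u, u', hu, hu', rfl⟩
  exact h u u' hu hu'

theorem star_projComm (u u' : A) : star (projComm u u') = -projComm u u' := by
  simp only [projComm, star_sub, star_mul, star_star, neg_sub]

theorem map_projComm {B F : Type} [NonUnitalRing B] [StarRing B] [FunLike F A B]
    [NonUnitalRingHomClass F A B] [StarHomClass F A B] (f : F) (u u' : A) :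
    f (projComm u u') = projComm (f u) (f u') := by
  simp only [projComm, map_sub, map_mul, map_star]

theorem star_mem_tameIdeal {x : A} (hx : x ∈ tameIdeal S) : star x ∈ tameIdeal S := by
  let I : TwoSidedIdeal A := TwoSidedIdeal.mk' {x | star x ∈ tameIdeal S}
    (by simp)
    (fun hx hy => by simpa using (tameIdeal S).add_mem hx hy)
    (fun hx => by simpa using (tameIdeal S).neg_mem hx)
    (fun hy => by simpa using (tameIdeal S).mul_mem_right _ _ hy)
    (fun hx => by simpa using (tameIdeal S).mul_mem_left _ _ hx)
  have h : tameIdeal S ≤ I := tameIdeal_le fun u u' hu hu' => by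
    simp only [I, TwoSidedIdeal.mem_mk', Set.mem_ofPred_eq, star_projComm]
    exact (tameIdeal S).neg_mem (projComm_mem_tameIdeal hu hu')
  simpa only [I, TwoSidedIdeal.mem_mk', Set.mem_ofPred_eq] using h hx

theorem isTameSet_iff_projComm : IsTameSet S ↔
    ∀ u u', StarSemigroup S u → StarSemigroup S u' → projComm u u' = 0 := by
  simp only [IsTameSet, projComm, sub_eq_zero]

theorem tameIdeal_le_ker {B F : Type} [NonUnitalRing B] [StarRing B] [FunLike F A B]
    [NonUnitalRingHomClass F A B] [StarHomClass F A B] (f : F) {T : Set B} (hT : IsTameSet T)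
    (hf : ∀ x ∈ S, f x ∈ T) {x : A} (hx : x ∈ tameIdeal S) : f x = 0 := by
  have h : tameIdeal S ≤ TwoSidedIdeal.ker f := tameIdeal_le fun u u' hu hu' => by
    rw [TwoSidedIdeal.mem_ker, map_projComm]
    refine isTameSet_iff_projComm.1 hT _ _ ?_ ?_ <;>
    exact StarSemigroup.map f (map_mul f) (map_star f) (fun x hx => .base (hf x hx)) ‹_›
  exact (TwoSidedIdeal.mem_ker f).1 (h hx)

theorem isTameSet_of_tameIdeal_le_ker {B F : Type} [NonUnitalRing B] [StarRing B] [FunLike F A B]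
    [NonUnitalRingHomClass F A B] [StarHomClass F A B] (f : F) {T : Set B}
    (hT : ∀ y ∈ T, ∃ x ∈ S, f x = y) (hf : ∀ x ∈ tameIdeal S, f x = 0) : IsTameSet T := by
  rw [isTameSet_iff_projComm]
  intro u u' hu hu'
  obtain ⟨x, hx, rfl⟩ := hu.exists_lift f (map_mul f) (map_star f) hT
  obtain ⟨x', hx', rfl⟩ := hu'.exists_lift f (map_mul f) (map_star f) hT
  rw [← map_projComm]
  exact hf _ (projComm_mem_tameIdeal hx hx')

end

theorem NonUnitalStarAlgHom.exists_comp_eq_of_surjective {K A B C : Type} [Field K]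
    [NonUnitalRing A] [Module K A] [StarRing A] [NonUnitalRing B] [Module K B] [StarRing B]
    [NonUnitalRing C] [Module K C] [StarRing C]
    (f : A →⋆ₙₐ[K] B) (hf : Function.Surjective f) (g : A →⋆ₙₐ[K] C)
    (hfg : ∀ x, f x = 0 → g x = 0) : ∃ h : B →⋆ₙₐ[K] C, ∀ x, h (f x) = g x := by
  have key : ∀ x y, f x = f y → g x = g y := fun x y hxy => by
    rw [← sub_eq_zero, ← map_sub]
    exact hfg _ (by rw [map_sub, hxy, sub_self])
  choose k hk using hf
  have hgk : ∀ x, g (k (f x)) = g x := fun x => key _ _ (hk _)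
  refine ⟨{ toFun := fun b => g (k b), map_smul' := fun c b => ?_, map_zero' := ?_,
            map_add' := fun b b' => ?_, map_mul' := fun b b' => ?_, map_star' := fun b => ?_ }, hgk⟩
  · rw [MonoidHom.id_apply, ← map_smul]
    exact key _ _ (by rw [hk, map_smul, hk])
  · rw [← map_zero g]
    exact key _ _ (by rw [hk, map_zero])
  · rw [← map_add]
    exact key _ _ (by rw [hk, map_add, hk, hk])
  · rw [← map_mul]
    exact key _ _ (by rw [hk, map_mul, hk, hk])
  · rw [← map_star]
    exact key _ _ (by rw [hk, map_star, hk])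

variable {A : Type} [NonUnitalRing A] [Module K A] [SMulCommClass K A A] [IsScalarTower K A A]
  [StarRing A] [StarModule K A]

/-- The quotient of a `*`-algebra by a `*`-invariant two-sided ideal that is a subspace. -/
theorem exists_quotient_starAlgebra (I : TwoSidedIdeal A)
    (hsmul : ∀ (c : K) (x : A), x ∈ I → c • x ∈ I) (hstar : ∀ x ∈ I, star x ∈ I) :
    ∃ (Q : Type) (_ : NonUnitalRing Q) (_ : Module K Q) (_ : SMulCommClass K Q Q)
      (_ : IsScalarTower K Q Q) (_ : StarRing Q) (_ : StarModule K Q) (f : A →⋆ₙₐ[K] Q),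
      Function.Surjective f ∧ ∀ x, f x = 0 ↔ x ∈ I := by
  let Q := I.ringCon.Quotient
  let q : A →+ Q :=
    { toFun := fun x => (x : Q)
      map_zero' := rfl
      map_add' := fun _ _ => rfl }
  have hmul : ∀ x y, q (x * y) = q x * q y := fun _ _ => rfl
  have hq : Function.Surjective q := Quotient.mk_surjective
  have hq_eq : ∀ x y, q x = q y ↔ x - y ∈ I := fun x y =>
    (RingCon.eq _).trans (I.rel_iff x y)
  have hq_zero : ∀ x, q x = 0 ↔ x ∈ I := fun x => by
    rw [← map_zero q, hq_eq, sub_zero]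
  let iS : SMul K Q := ⟨fun c => Quotient.map' (c • ·) fun x y h => by
    have h' : x - y ∈ I := (I.rel_iff x y).1 h
    refine (I.rel_iff _ _).2 ?_
    rw [← smul_sub]
    exact hsmul c _ h'⟩
  have hq_smul : ∀ (c : K) x, q (c • x) = c • q x := fun _ _ => rfl
  let iM : Module K Q := hq.module K q hq_smul
  let iStar : Star Q := ⟨Quotient.map' star fun x y h => by
    have h' : x - y ∈ I := (I.rel_iff x y).1 h
    refine (I.rel_iff _ _).2 ?_
    rw [← star_sub]
    exact hstar _ h'⟩
  have hq_star : ∀ x, q (star x) = star (q x) := fun _ => rfl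
  let iSR : StarRing Q :=
    { star_involutive := fun x => by
        obtain ⟨x, rfl⟩ := hq x
        rw [← hq_star, ← hq_star, star_star]
      star_mul := fun x y => by
        obtain ⟨x, rfl⟩ := hq x
        obtain ⟨y, rfl⟩ := hq y
        rw [← hmul, ← hq_star, star_mul, hmul, hq_star, hq_star]
      star_add := fun x y => by
        obtain ⟨x, rfl⟩ := hq x
        obtain ⟨y, rfl⟩ := hq y
        rw [← map_add, ← hq_star, star_add, map_add, hq_star, hq_star] }
  refine ⟨Q, inferInstance, iM, ⟨fun c x y => ?_⟩, ⟨fun c x y => ?_⟩, iSR, ⟨fun c x => ?_⟩,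
    { toFun := q
      map_smul' := hq_smul
      map_zero' := map_zero q
      map_add' := map_add q
      map_mul' := hmul
      map_star' := hq_star }, hq, hq_zero⟩
  · obtain ⟨x, rfl⟩ := hq x
    obtain ⟨y, rfl⟩ := hq y
    change c • (q x * q y) = q x * c • q y
    rw [← hmul, ← hq_smul, ← hq_smul, ← hmul, mul_smul_comm]
  · obtain ⟨x, rfl⟩ := hq x
    obtain ⟨y, rfl⟩ := hq y
    change (c • q x) * q y = c • (q x * q y)
    rw [← hmul, ← hq_smul, ← hq_smul, ← hmul, smul_mul_assoc]
  · obtain ⟨x, rfl⟩ := hq x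
    rw [← hq_smul, ← hq_star, star_smul, hq_smul, hq_star]

end StarAlgebra

section Representations

variable {K} {G : BipSepGraph}
variable {A : Type} [NonUnitalRing A] [Module K A] [SMulCommClass K A A] [IsScalarTower K A A]
  [StarRing A] [StarModule K A]
variable {B : Type} [NonUnitalRing B] [Module K B] [SMulCommClass K B B] [IsScalarTower K B B]
  [StarRing B] [StarModule K B]

/-- The image of a representation under a `*`-homomorphism. -/
def LPARep.map (ρ : LPARep K G A) (f : A →⋆ₙₐ[K] B) : LPARep K G B where
  pv u := f (ρ.pv u)
  ge e := f (ρ.ge e)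
  pv_star u := by rw [← map_star, ρ.pv_star]
  pv_idem u := by rw [← map_mul, ρ.pv_idem]
  pv_orth u u' h := by rw [← map_mul, ρ.pv_orth u u' h, map_zero]
  src_mul e := by rw [← map_mul, ρ.src_mul]
  mul_rng e := by rw [← map_mul, ρ.mul_rng]
  sck1 e e' h := by
    rw [← map_star, ← map_mul, ρ.sck1 e e' h]
    split_ifs <;> simp
  sck2 e := by simp only [← map_star, ← map_mul, ← map_sum, ρ.sck2]

/-- The image of a representation under a `*`-homomorphism. -/
def LVRep.map (σ : LVRep K G A) (f : A →⋆ₙₐ[K] B) : LVRep K G B where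
  pv v := f (σ.pv v)
  tau e e' := f (σ.tau e e')
  pv_star v := by rw [← map_star, σ.pv_star]
  pv_idem v := by rw [← map_mul, σ.pv_idem]
  pv_orth v v' h := by rw [← map_mul, σ.pv_orth v v' h, map_zero]
  tau_star e e' h := by rw [← map_star, σ.tau_star e e' h]
  tau_right e e' h := by rw [← map_mul, σ.tau_right e e' h]
  tau_left e e' h := by rw [← map_mul, σ.tau_left e e' h]
  sck1 e e' g h h₁ h₂ h₃ := by
    rw [← map_mul, σ.sck1 e e' g h h₁ h₂ h₃]
    split_ifs <;> simp
  sck2 g := by rw [← map_sum, σ.sck2]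

theorem LPARep.star_mul_self (ρ : LPARep K G A) (e : G.E) :
    star (ρ.ge e) * ρ.ge e = ρ.pv (inr (G.r e)) := by
  rw [ρ.sck1 e e (G.c_equiv.refl e), if_pos rfl]

theorem LPARep.ge_mul_star_mul_self (ρ : LPARep K G A) (e : G.E) :
    ρ.ge e * star (ρ.ge e) * ρ.ge e = ρ.ge e := by
  rw [mul_assoc, ρ.star_mul_self, ρ.mul_rng]

theorem LPARep.star_ge_mul_src (ρ : LPARep K G A) (e : G.E) :
    star (ρ.ge e) * ρ.pv (inl (G.s e)) = star (ρ.ge e) := by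
  rw [← ρ.pv_star, ← star_mul, ρ.src_mul]

theorem LPARep.rng_mul_star_ge (ρ : LPARep K G A) (e : G.E) :
    ρ.pv (inr (G.r e)) * star (ρ.ge e) = star (ρ.ge e) := by
  rw [← ρ.pv_star, ← star_mul, ρ.mul_rng]

theorem LPARep.ge_mul_star_ge_of_ne (ρ : LPARep K G A) {e f : G.E} (h : G.r e ≠ G.r f) :
    ρ.ge e * star (ρ.ge f) = 0 := by
  rw [← ρ.mul_rng e, ← ρ.rng_mul_star_ge f, mul_assoc, ← mul_assoc (ρ.pv _),
    ρ.pv_orth _ _ (by simpa using h), zero_mul, mul_zero]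

/-- The representation of the relations of `LV(E,C)` induced by one of those of `L(E,C)`. -/
def LPARep.toLVRep (ρ : LPARep K G A) : LVRep K G A where
  pv v := ρ.pv (inl v)
  tau e f := ρ.ge e * star (ρ.ge f)
  pv_star v := ρ.pv_star _
  pv_idem v := ρ.pv_idem _
  pv_orth v v' h := ρ.pv_orth _ _ (by simpa using h)
  tau_star e f _ := by rw [star_mul, star_star]
  tau_right e f _ := by rw [mul_assoc, ρ.star_ge_mul_src]
  tau_left e f _ := by rw [← mul_assoc, ρ.src_mul]
  sck1 e f g h h₁ _ h₃ := by
    rw [mul_assoc, ← mul_assoc (star _), ρ.sck1 f g h₃]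
    split_ifs with hfg
    · rw [← mul_assoc, ← h₁, ρ.mul_rng]
    · rw [zero_mul, mul_zero]
  sck2 g := ρ.sck2 g

theorem LPARep.starSemigroup_ge (ρ : LPARep K G A) (e : G.E) :
    StarSemigroup (ρ.genSet K) (ρ.ge e) :=
  .base ⟨e, rfl⟩

theorem LPARep.starSemigroup_of_toLVRep (ρ : LPARep K G A) {w : A}
    (hw : StarSemigroup (ρ.toLVRep.genSet K) w) : StarSemigroup (ρ.genSet K) w := by
  refine StarSemigroup.map id (fun _ _ => rfl) (fun _ => rfl) ?_ hw
  rintro _ ⟨e, f, _, rfl⟩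
  exact (ρ.starSemigroup_ge e).mul_mem (ρ.starSemigroup_ge f).star_mem

theorem LPARep.Tame.toLVRep {ρ : LPARep K G A} (h : ρ.Tame K) : ρ.toLVRep.Tame K :=
  fun u u' hu hu' => h u u' (ρ.starSemigroup_of_toLVRep hu) (ρ.starSemigroup_of_toLVRep hu')

theorem LVRep.exists_left_right (σ : LVRep K G A) {w : A} (hw : StarSemigroup (σ.genSet K) w) :
    (∃ v, σ.pv v * w = w) ∧ ∃ v, w * σ.pv v = w := by
  induction hw with
  | base h =>
    obtain ⟨e, f, hef, rfl⟩ := h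
    exact ⟨⟨_, σ.tau_left e f hef⟩, ⟨_, σ.tau_right e f hef⟩⟩
  | star_mem _ ih =>
    obtain ⟨⟨v, hv⟩, ⟨v', hv'⟩⟩ := ih
    refine ⟨⟨v', ?_⟩, ⟨v, ?_⟩⟩
    · rw [← σ.pv_star, ← star_mul, hv']
    · rw [← σ.pv_star, ← star_mul, hv]
  | mul_mem _ _ ih₁ ih₂ =>
    obtain ⟨⟨v, hv⟩, -⟩ := ih₁
    obtain ⟨-, ⟨v', hv'⟩⟩ := ih₂
    exact ⟨⟨v, by rw [← mul_assoc, hv]⟩, ⟨v', by rw [mul_assoc, hv']⟩⟩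

/-- `t` is a product of edges and ghost edges that starts with an edge. -/
def LPARep.StartsUpper (ρ : LPARep K G A) (t : A) : Prop :=
  ∃ w, StarSemigroup (ρ.toLVRep.genSet K) w ∧ (t = w ∨ ∃ f, t = w * ρ.ge f)

namespace LPARep

variable {ρ : LPARep K G A}

theorem StartsUpper.ge (e : G.E) : ρ.StartsUpper (ρ.ge e) :=
  ⟨ρ.ge e * star (ρ.ge e), .base ⟨e, e, rfl, rfl⟩, .inr ⟨e, (ρ.ge_mul_star_mul_self e).symm⟩⟩

theorem StartsUpper.mul_left {w t : A} (hw : StarSemigroup (ρ.toLVRep.genSet K) w)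
    (ht : ρ.StartsUpper t) : ρ.StartsUpper (w * t) := by
  obtain ⟨w', hw', rfl | ⟨f, rfl⟩⟩ := ht
  · exact ⟨w * t, hw.mul_mem hw', .inl rfl⟩
  · exact ⟨w * w', hw.mul_mem hw', .inr ⟨f, (mul_assoc _ _ _).symm⟩⟩

theorem StartsUpper.exists_left {t : A} (ht : ρ.StartsUpper t) :
    ∃ v : G.V0, ρ.pv (inl v) * t = t := by
  obtain ⟨w, hw, h⟩ := ht
  obtain ⟨⟨v, hv⟩, -⟩ := ρ.toLVRep.exists_left_right hw
  change ρ.pv (inl v) * w = w at hv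
  obtain rfl | ⟨f, rfl⟩ := h
  · exact ⟨v, hv⟩
  · exact ⟨v, by rw [← mul_assoc, hv]⟩

theorem StartsUpper.exists_mul_star_self {t : A} (ht : ρ.StartsUpper t) :
    ∃ w, StarSemigroup (ρ.toLVRep.genSet K) w ∧ t * star t = w * star w := by
  obtain ⟨w, hw, rfl | ⟨f, rfl⟩⟩ := ht
  · exact ⟨t, hw, rfl⟩
  · refine ⟨w * (ρ.ge f * star (ρ.ge f)), hw.mul_mem (.base ⟨f, f, rfl, rfl⟩), ?_⟩
    calc w * ρ.ge f * star (w * ρ.ge f)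
        = w * (ρ.ge f * star (ρ.ge f) * ρ.ge f) * star (w * ρ.ge f) := by
          rw [ρ.ge_mul_star_mul_self]
      _ = _ := by simp only [star_mul, star_star, mul_assoc]

theorem StartsUpper.exists_projComm_eq {t t' : A} (ht : ρ.StartsUpper t)
    (ht' : ρ.StartsUpper t') : ∃ w w', StarSemigroup (ρ.toLVRep.genSet K) w ∧
      StarSemigroup (ρ.toLVRep.genSet K) w' ∧ projComm t t' = projComm w w' := by
  obtain ⟨w, hw, h⟩ := ht.exists_mul_star_self
  obtain ⟨w', hw', h'⟩ := ht'.exists_mul_star_self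
  exact ⟨w, w', hw, hw', by rw [projComm, h, h', projComm]⟩

/-- The possible shapes of an element of the `*`-semigroup generated by the edges. -/
def IsWord (ρ : LPARep K G A) (u : A) : Prop :=
  u = 0 ∨ ρ.StartsUpper u ∨ ∃ e t, ρ.StartsUpper t ∧ u = star (ρ.ge e) * t

theorem IsWord.ge_mul (e : G.E) {u : A} (hu : ρ.IsWord u) :
    ρ.ge e * u = 0 ∨ ρ.StartsUpper (ρ.ge e * u) := by
  obtain rfl | hu | ⟨f, t, ht, rfl⟩ := hu
  · exact .inl (mul_zero _)
  · obtain ⟨v, hv⟩ := hu.exists_left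
    left
    rw [← hv, ← ρ.mul_rng e, mul_assoc, ← mul_assoc (ρ.pv _), ρ.pv_orth _ _ (by simp), zero_mul,
      mul_zero]
  · rw [← mul_assoc]
    by_cases h : G.r e = G.r f
    · exact .inr (ht.mul_left (.base ⟨e, f, h, rfl⟩))
    · exact .inl (by rw [ρ.ge_mul_star_ge_of_ne h, zero_mul])

theorem IsWord.star_ge_mul (e : G.E) {u : A} (hu : ρ.IsWord u) :
    ρ.IsWord (star (ρ.ge e) * u) := by
  obtain rfl | hu | ⟨f, t, ht, rfl⟩ := hu
  · exact .inl (mul_zero _)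
  · exact .inr (.inr ⟨e, u, hu, rfl⟩)
  · left
    rw [← ρ.star_ge_mul_src e, ← ρ.rng_mul_star_ge f, mul_assoc, ← mul_assoc (ρ.pv _),
      ← mul_assoc (ρ.pv _), ρ.pv_orth _ _ (by simp), zero_mul, zero_mul, mul_zero]

theorem isWord {u : A} (hu : StarSemigroup (ρ.genSet K) u) : ρ.IsWord u := by
  suffices h : (ρ.IsWord u ∧ ρ.IsWord (star u)) ∧
      ∀ t, ρ.IsWord t → ρ.IsWord (u * t) ∧ ρ.IsWord (star u * t) from h.1.1
  induction hu with
  | base h =>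
    obtain ⟨e, rfl⟩ := h
    refine ⟨⟨.inr (.inl (.ge e)), .inr (.inr ⟨e, _, ⟨_, .base ⟨e, e, rfl, rfl⟩, .inl rfl⟩, ?_⟩)⟩,
      fun t ht => ⟨(ht.ge_mul e).imp_right .inl, ht.star_ge_mul e⟩⟩
    change _ = star (ρ.ge e) * (ρ.ge e * star (ρ.ge e))
    rw [← mul_assoc, ρ.star_mul_self, ρ.rng_mul_star_ge]
  | star_mem _ ih =>
    rw [star_star]
    exact ⟨ih.1.symm, fun t ht => (ih.2 t ht).symm⟩
  | mul_mem _ _ ih₁ ih₂ =>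
    simp only [star_mul, mul_assoc]
    exact ⟨⟨(ih₁.2 _ ih₂.1.1).1, (ih₂.2 _ ih₁.1.2).2⟩,
      fun t ht => ⟨(ih₁.2 _ (ih₂.2 t ht).1).1, (ih₂.2 _ (ih₁.2 t ht).2).2⟩⟩

theorem projComm_eq_zero_of_ne {p q : G.V0 ⊕ G.V1} (hpq : p ≠ q) {u u' : A}
    (hu : ρ.pv p * u = u) (hu' : ρ.pv q * u' = u') : projComm u u' = 0 := by
  have h₁ : star u * u' = 0 := by
    rw [← hu, ← hu', star_mul, ρ.pv_star, mul_assoc, ← mul_assoc (ρ.pv p), ρ.pv_orth p q hpq,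
      zero_mul, mul_zero]
  have h₂ : star u' * u = 0 := by
    rw [← star_star u, ← star_mul, h₁, star_zero]
  rw [projComm, mul_assoc u, ← mul_assoc (star u), h₁, mul_assoc u', ← mul_assoc (star u'), h₂]
  simp

theorem pv_mul_projComm_mul_pv {p : G.V0 ⊕ G.V1} {u u' : A}
    (hu : ρ.pv p * u = u) (hu' : ρ.pv p * u' = u') :
    ρ.pv p * projComm u u' * ρ.pv p = projComm u u' := by
  have h : star u * ρ.pv p = star u := by rw [← ρ.pv_star, ← star_mul, hu]
  have h' : star u' * ρ.pv p = star u' := by rw [← ρ.pv_star, ← star_mul, hu']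
  simp only [projComm, mul_sub, sub_mul, mul_assoc, h, h']
  simp only [← mul_assoc, hu, hu']

theorem ge_mul_projComm_mul_star (e : G.E) {u u' : A} (hu : ρ.pv (inr (G.r e)) * u = u)
    (hu' : ρ.pv (inr (G.r e)) * u' = u') :
    ρ.ge e * projComm u u' * star (ρ.ge e) = projComm (ρ.ge e * u) (ρ.ge e * u') := by
  have h : ∀ x, star (ρ.ge e) * (ρ.ge e * (u * x)) = u * x := fun x => by
    rw [← mul_assoc, ρ.star_mul_self, ← mul_assoc, hu]
  have h' : ∀ x, star (ρ.ge e) * (ρ.ge e * (u' * x)) = u' * x := fun x => by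
    rw [← mul_assoc, ρ.star_mul_self, ← mul_assoc, hu']
  simp only [projComm, mul_sub, sub_mul, mul_assoc, star_mul, h, h']

/-- A generator of the ideal of commutators lives either in an upper corner or in a lower corner;
in the latter case it is moved to an upper corner by conjugation with an edge. -/
theorem projComm_cases {u u' : A} (hu : StarSemigroup (ρ.genSet K) u)
    (hu' : StarSemigroup (ρ.genSet K) u') :
    projComm u u' = 0 ∨
    (∃ v : G.V0, ρ.pv (inl v) * projComm u u' * ρ.pv (inl v) = projComm u u' ∧
      ∃ w w', StarSemigroup (ρ.toLVRep.genSet K) w ∧ StarSemigroup (ρ.toLVRep.genSet K) w' ∧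
        projComm u u' = projComm w w') ∨
    (∃ e, ρ.pv (inr (G.r e)) * projComm u u' * ρ.pv (inr (G.r e)) = projComm u u' ∧
      ∃ w w', StarSemigroup (ρ.toLVRep.genSet K) w ∧ StarSemigroup (ρ.toLVRep.genSet K) w' ∧
        ρ.ge e * projComm u u' * star (ρ.ge e) = projComm w w') := by
  have rng : ∀ e t, ρ.pv (inr (G.r e)) * (star (ρ.ge e) * t) = star (ρ.ge e) * t := fun e t => by
    rw [← mul_assoc, ρ.rng_mul_star_ge]
  have hw := isWord hu
  have hw' := isWord hu'
  obtain rfl | hu | ⟨e, t, ht, hut⟩ := isWord hu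
  · exact .inl (by simp [projComm])
  · obtain ⟨v, hv⟩ := hu.exists_left
    obtain rfl | hu' | ⟨e, t, ht, rfl⟩ := isWord hu'
    · exact .inl (by simp [projComm])
    · obtain ⟨v', hv'⟩ := hu'.exists_left
      obtain rfl | hne := eq_or_ne v v'
      · exact .inr (.inl ⟨v, pv_mul_projComm_mul_pv hv hv', hu.exists_projComm_eq hu'⟩)
      · exact .inl (projComm_eq_zero_of_ne (by simpa using hne) hv hv')
    · exact .inl (projComm_eq_zero_of_ne (by simp) hv (rng e t))
  · have hv : ρ.pv (inr (G.r e)) * u = u := hut ▸ rng e t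
    obtain rfl | hu' | ⟨f, t', ht', hut'⟩ := isWord hu'
    · exact .inl (by simp [projComm])
    · obtain ⟨v', hv'⟩ := hu'.exists_left
      exact .inl (projComm_eq_zero_of_ne (by simp) hv hv')
    · have hv' : ρ.pv (inr (G.r f)) * u' = u' := hut' ▸ rng f t'
      obtain hef | hne := eq_or_ne (G.r e) (G.r f)
      · rw [← hef] at hv'
        have hconj := ge_mul_projComm_mul_star e hv hv'
        have hz := pv_mul_projComm_mul_pv hv hv'
        have hz' : ρ.ge e * projComm u u' * star (ρ.ge e) = 0 → projComm u u' = 0 := fun h0 => by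
          rw [← hz, ← ρ.star_mul_self]
          calc _ = star (ρ.ge e) * (ρ.ge e * projComm u u' * star (ρ.ge e)) * ρ.ge e := by
                simp only [mul_assoc]
            _ = 0 := by rw [h0, mul_zero, zero_mul]
        obtain h | h := hw.ge_mul e
        · exact .inl (hz' (by rw [hconj, h]; simp [projComm]))
        obtain h' | h' := hw'.ge_mul e
        · exact .inl (hz' (by rw [hconj, h']; simp [projComm]))
        exact .inr (.inr ⟨e, hz, hconj ▸ h.exists_projComm_eq h'⟩)
      · exact .inl (projComm_eq_zero_of_ne (by simpa using hne) hv hv')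

theorem smul_mem_tameIdeal (c : K) {x : A} (hx : x ∈ tameIdeal (ρ.genSet K)) :
    c • x ∈ tameIdeal (ρ.genSet K) := by
  set J := tameIdeal (ρ.genSet K)
  let I : TwoSidedIdeal A := TwoSidedIdeal.mk' {x | c • x ∈ J}
    (by simp)
    (fun hx hy => by simpa using J.add_mem hx hy)
    (fun hx => by simpa using J.neg_mem hx)
    (fun hy => by simpa [← mul_smul_comm] using J.mul_mem_left _ _ hy)
    (fun hx => by simpa [← smul_mul_assoc] using J.mul_mem_right _ _ hx)
  have h : J ≤ I := tameIdeal_le fun u u' hu hu' => by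
    have hmem : projComm u u' ∈ J := projComm_mem_tameIdeal hu hu'
    simp only [I, TwoSidedIdeal.mem_mk', Set.mem_ofPred_eq]
    have key : ∀ p, ρ.pv p * projComm u u' * ρ.pv p = projComm u u' → c • projComm u u' ∈ J :=
      fun p hp => by
        rw [← hp, mul_assoc, ← smul_mul_assoc]
        exact J.mul_mem_left _ _ (J.mul_mem_right _ _ hmem)
    obtain h | ⟨v, h, -⟩ | ⟨e, h, -⟩ := projComm_cases hu hu'
    · rw [h, smul_zero]
      exact J.zero_mem
    · exact key _ h
    · exact key _ h
  simpa only [I, TwoSidedIdeal.mem_mk', Set.mem_ofPred_eq] using h hx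

end LPARep

theorem LPARep.map_tame {ρ : LPARep K G A} (f : A →⋆ₙₐ[K] B)
    (hf : ∀ x ∈ tameIdeal (ρ.genSet K), f x = 0) : (ρ.map f).Tame K := by
  refine isTameSet_of_tameIdeal_le_ker f ?_ hf
  rintro _ ⟨e, rfl⟩
  exact ⟨_, ⟨e, rfl⟩, rfl⟩

theorem LVRep.map_tame {σ : LVRep K G A} (f : A →⋆ₙₐ[K] B)
    (hf : ∀ x ∈ tameIdeal (σ.genSet K), f x = 0) : (σ.map f).Tame K := by
  refine isTameSet_of_tameIdeal_le_ker f ?_ hf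
  rintro _ ⟨e, e', h, rfl⟩
  exact ⟨_, ⟨e, e', h, rfl⟩, rfl⟩

/-- `L^{ab}(E,C)` is the quotient of `L(E,C)` by the ideal of commutators. -/
theorem IsLPA.exists_surjective_ker {ρ : LPARep K G A} (hA : IsLPA K G A ρ) {ρ' : LPARep K G B}
    (hB : IsLPAab K G B ρ') : ∃ f : A →⋆ₙₐ[K] B, (∀ u, f (ρ.pv u) = ρ'.pv u) ∧
      (∀ e, f (ρ.ge e) = ρ'.ge e) ∧ Function.Surjective f ∧
      ∀ x, f x = 0 ↔ x ∈ tameIdeal (ρ.genSet K) := by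
  obtain ⟨f, ⟨hfv, hfe⟩, -⟩ := hA B ρ'
  have hf : ∀ x ∈ tameIdeal (ρ.genSet K), f x = 0 := fun x hx => by
    refine tameIdeal_le_ker f hB.1 ?_ hx
    rintro _ ⟨e, rfl⟩
    exact ⟨e, (hfe e).symm⟩
  obtain ⟨Q, _, _, _, _, _, _, q, hq, hq_zero⟩ := exists_quotient_starAlgebra (K := K)
    (tameIdeal (ρ.genSet K)) (fun c x => LPARep.smul_mem_tameIdeal c)
    (fun x => star_mem_tameIdeal)
  have hqv (u) : (ρ.map q).pv u = q (ρ.pv u) := rfl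
  have hqe (e) : (ρ.map q).ge e = q (ρ.ge e) := rfl
  obtain ⟨h, hh⟩ := q.exists_comp_eq_of_surjective hq f (fun x hx => hf x ((hq_zero x).1 hx))
  obtain ⟨k, ⟨hkv, hke⟩, -⟩ := hB.2 Q (ρ.map q) (LPARep.map_tame q fun x => (hq_zero x).2)
  have h_left : h.comp k = NonUnitalStarAlgHom.id K B :=
    (hB.2 B ρ' hB.1).unique
      ⟨fun u => by simp [hkv, hqv, hh, hfv], fun e => by simp [hke, hqe, hh, hfe]⟩
      ⟨fun u => rfl, fun e => rfl⟩
  have h_right : k.comp f = q :=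
    (hA Q (ρ.map q)).unique
      ⟨fun u => by simp [hkv, hfv], fun e => by simp [hke, hfe]⟩
      ⟨fun u => rfl, fun e => rfl⟩
  refine ⟨f, hfv, hfe, fun b => ?_, fun x => ⟨fun hx => ?_, hf x⟩⟩
  · obtain ⟨a, ha⟩ := hq (k b)
    exact ⟨a, by rw [← hh, ha]; exact DFunLike.congr_fun h_left b⟩
  · rw [← hq_zero, ← h_right, NonUnitalStarAlgHom.comp_apply, hx, map_zero]

/-- `LV^{ab}(E,C)` is the quotient of `LV(E,C)` by the ideal of commutators. -/
theorem IsLV.exists_surjective_ker {σ : LVRep K G A} (hA : IsLV K G A σ) {σ' : LVRep K G B}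
    (hB : IsLVab K G B σ')
    (hsmul : ∀ (c : K) (x : A), x ∈ tameIdeal (σ.genSet K) → c • x ∈ tameIdeal (σ.genSet K)) :
    ∃ f : A →⋆ₙₐ[K] B, (∀ v, f (σ.pv v) = σ'.pv v) ∧
      (∀ e e', G.r e = G.r e' → f (σ.tau e e') = σ'.tau e e') ∧ Function.Surjective f ∧
      ∀ x, f x = 0 ↔ x ∈ tameIdeal (σ.genSet K) := by
  obtain ⟨f, ⟨hfv, hfe⟩, -⟩ := hA B σ'
  have hf : ∀ x ∈ tameIdeal (σ.genSet K), f x = 0 := fun x hx => by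
    refine tameIdeal_le_ker f hB.1 ?_ hx
    rintro _ ⟨e, e', h, rfl⟩
    exact ⟨e, e', h, hfe e e' h⟩
  obtain ⟨Q, _, _, _, _, _, _, q, hq, hq_zero⟩ := exists_quotient_starAlgebra (K := K)
    (tameIdeal (σ.genSet K)) hsmul (fun x => star_mem_tameIdeal)
  have hqv (v) : (σ.map q).pv v = q (σ.pv v) := rfl
  have hqe (e e') : (σ.map q).tau e e' = q (σ.tau e e') := rfl
  obtain ⟨h, hh⟩ := q.exists_comp_eq_of_surjective hq f (fun x hx => hf x ((hq_zero x).1 hx))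
  obtain ⟨k, ⟨hkv, hke⟩, -⟩ := hB.2 Q (σ.map q) (LVRep.map_tame q fun x => (hq_zero x).2)
  have h_left : h.comp k = NonUnitalStarAlgHom.id K B :=
    (hB.2 B σ' hB.1).unique
      ⟨fun v => by simp [hkv, hqv, hh, hfv],
        fun e e' hee' => by simp [hke e e' hee', hqe, hh, hfe e e' hee']⟩
      ⟨fun v => rfl, fun e e' _ => rfl⟩
  have h_right : k.comp f = q :=
    (hA Q (σ.map q)).unique
      ⟨fun v => by simp [hkv, hfv], fun e e' hee' => by simp [hke e e' hee', hfe e e' hee']⟩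
      ⟨fun v => rfl, fun e e' _ => rfl⟩
  refine ⟨f, hfv, hfe, fun b => ?_, fun x => ⟨fun hx => ?_, hf x⟩⟩
  · obtain ⟨a, ha⟩ := hq (k b)
    exact ⟨a, by rw [← hh, ha]; exact DFunLike.congr_fun h_left b⟩
  · rw [← hq_zero, ← h_right, NonUnitalStarAlgHom.comp_apply, hx, map_zero]

/-- The corner of `L(E,C)` spanned by the elements `u a w` with `u, w ∈ E^{0,0}`. -/
abbrev LPARep.corner (ρ : LPARep K G A) : Submodule K A :=
  Submodule.span K {x : A | ∃ (u w : G.V0) (a : A), x = ρ.pv (inl u) * a * ρ.pv (inl w)}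

theorem LPARep.mem_corner (ρ : LPARep K G A) (u w : G.V0) (a : A) :
    ρ.pv (inl u) * a * ρ.pv (inl w) ∈ ρ.corner :=
  Submodule.subset_span ⟨u, w, a, rfl⟩

theorem LPARep.exists_sum_eq_of_mem_corner (ρ : LPARep K G A) {x : A} (hx : x ∈ ρ.corner) :
    ∃ F : Finset G.V0, ∑ v ∈ F, ∑ w ∈ F, ρ.pv (inl v) * x * ρ.pv (inl w) = x := by
  suffices h : ∃ F : Finset G.V0, ∀ F', F ⊆ F' →
      ∑ v ∈ F', ∑ w ∈ F', ρ.pv (inl v) * x * ρ.pv (inl w) = x by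
    obtain ⟨F, hF⟩ := h
    exact ⟨F, hF F subset_rfl⟩
  induction hx using Submodule.span_induction with
  | mem x h =>
    obtain ⟨u, w, a, rfl⟩ := h
    refine ⟨{u, w}, fun F' hF' => ?_⟩
    have hleft : ∀ v, ρ.pv (inl v) * ρ.pv (inl u) = if v = u then ρ.pv (inl u) else 0 := by
      intro v
      split_ifs with h
      · rw [h, ρ.pv_idem]
      · exact ρ.pv_orth _ _ (by simpa using h)
    have hright : ∀ v, ρ.pv (inl w) * ρ.pv (inl v) = if v = w then ρ.pv (inl w) else 0 := by
      intro v
      split_ifs with h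
      · rw [h, ρ.pv_idem]
      · exact ρ.pv_orth _ _ (by simpa using Ne.symm h)
    have hu : u ∈ F' := hF' (by simp)
    have hw : w ∈ F' := hF' (by simp)
    have hterm : ∀ v v', ρ.pv (inl v) * (ρ.pv (inl u) * a * ρ.pv (inl w)) * ρ.pv (inl v') =
        if v = u then (if v' = w then ρ.pv (inl u) * a * ρ.pv (inl w) else 0) else 0 := by
      intro v v'
      calc _ = (ρ.pv (inl v) * ρ.pv (inl u)) * a * (ρ.pv (inl w) * ρ.pv (inl v')) := by
            simp only [mul_assoc]
        _ = _ := by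
            rw [hleft, hright]
            split_ifs <;> simp
    simp [hterm, Finset.sum_ite_eq', hu, hw]
  | zero => exact ⟨∅, fun F' _ => by simp⟩
  | add x y _ _ ihx ihy =>
    obtain ⟨F, hF⟩ := ihx
    obtain ⟨F₂, hF₂⟩ := ihy
    refine ⟨F ∪ F₂, fun F' hF' => ?_⟩
    simp only [mul_add, add_mul, Finset.sum_add_distrib]
    rw [hF F' (Finset.union_subset_left hF'), hF₂ F' (Finset.union_subset_right hF')]
  | smul c x _ ih =>
    obtain ⟨F, hF⟩ := ih
    refine ⟨F, fun F' hF' => ?_⟩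
    simp only [mul_smul_comm, smul_mul_assoc, ← Finset.smul_sum]
    rw [hF F' hF']

/-- The ideal of commutators of `L(E,C)` restricts to that of the corner `LV(E,C)`. -/
theorem LPARep.map_mem_tameIdeal_iff (ρ : LPARep K G A) (σ : LVRep K G B) (φ : B →⋆ₙₐ[K] A)
    (hinj : Function.Injective φ) (hrange : Set.range φ = ρ.corner)
    (hφτ : ∀ e f, G.r e = G.r f → φ (σ.tau e f) = ρ.ge e * star (ρ.ge f)) (x : B) :
    φ x ∈ tameIdeal (ρ.genSet K) ↔ x ∈ tameIdeal (σ.genSet K) := by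
  set J := tameIdeal (σ.genSet K)
  constructor
  · intro hx
    have hcorner : ∀ (v w : G.V0) (a : A),
        ∃ b, φ b = ρ.pv (inl v) * a * ρ.pv (inl w) := fun v w a => by
      change _ ∈ Set.range φ
      rw [hrange]
      exact ρ.mem_corner v w a
    have hcomm : ∀ w w', StarSemigroup (ρ.toLVRep.genSet K) w →
        StarSemigroup (ρ.toLVRep.genSet K) w' → ∃ y ∈ J, φ y = projComm w w' := by
      intro w w' hw hw'
      have hgen : ∀ y ∈ ρ.toLVRep.genSet K, ∃ x ∈ σ.genSet K, φ x = y := by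
        rintro _ ⟨e, f, hef, rfl⟩
        exact ⟨_, ⟨e, f, hef, rfl⟩, hφτ e f hef⟩
      obtain ⟨y, hy, rfl⟩ := hw.exists_lift φ (map_mul φ) (map_star φ) hgen
      obtain ⟨y', hy', rfl⟩ := hw'.exists_lift φ (map_mul φ) (map_star φ) hgen
      exact ⟨_, projComm_mem_tameIdeal hy hy', map_projComm φ y y'⟩
    let I : TwoSidedIdeal A := TwoSidedIdeal.mk'
      {z | ∀ (a b : A) (v w : G.V0), ∃ y ∈ J, φ y = ρ.pv (inl v) * (a * z * b) * ρ.pv (inl w)}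
      (fun a b v w => ⟨0, J.zero_mem, by simp⟩)
      (fun {z z'} hz hz' a b v w => by
        obtain ⟨y, hy, h⟩ := hz a b v w
        obtain ⟨y', hy', h'⟩ := hz' a b v w
        exact ⟨y + y', J.add_mem hy hy', by simp only [map_add, h, h', mul_add, add_mul]⟩)
      (fun {z} hz a b v w => by
        obtain ⟨y, hy, h⟩ := hz a b v w
        exact ⟨-y, J.neg_mem hy, by simp only [map_neg, h, mul_neg, neg_mul]⟩)
      (fun {c z} hz a b v w => by
        obtain ⟨y, hy, h⟩ := hz (a * c) b v w
        exact ⟨y, hy, by simp only [h, mul_assoc]⟩)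
      (fun {z c} hz a b v w => by
        obtain ⟨y, hy, h⟩ := hz a (c * b) v w
        exact ⟨y, hy, by simp only [h, mul_assoc]⟩)
    have hI : tameIdeal (ρ.genSet K) ≤ I := tameIdeal_le fun u u' hu hu' => by
      simp only [I, TwoSidedIdeal.mem_mk', Set.mem_ofPred_eq]
      intro a b v w
      obtain h | ⟨v', h, w₁, w₂, hw₁, hw₂, hz⟩ | ⟨e, h, w₁, w₂, hw₁, hw₂, hz⟩ :=
        projComm_cases hu hu'
      · exact ⟨0, J.zero_mem, by simp [h]⟩
      · obtain ⟨y, hy, hφy⟩ := hcomm w₁ w₂ hw₁ hw₂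
        obtain ⟨α, hα⟩ := hcorner v v' a
        obtain ⟨β, hβ⟩ := hcorner v' w b
        refine ⟨α * y * β, J.mul_mem_right _ _ (J.mul_mem_left _ _ hy), ?_⟩
        rw [map_mul, map_mul, hα, hβ, hφy, ← hz]
        nth_rw 2 [← h]
        simp only [mul_assoc]
      · obtain ⟨y, hy, hφy⟩ := hcomm w₁ w₂ hw₁ hw₂
        obtain ⟨α, hα⟩ := hcorner v (G.s e) (a * star (ρ.ge e))
        obtain ⟨β, hβ⟩ := hcorner (G.s e) w (ρ.ge e * b)
        rw [mul_assoc, mul_assoc a, ρ.star_ge_mul_src] at hα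
        rw [← mul_assoc, ρ.src_mul] at hβ
        refine ⟨α * y * β, J.mul_mem_right _ _ (J.mul_mem_left _ _ hy), ?_⟩
        rw [map_mul, map_mul, hα, hβ, hφy, ← hz]
        nth_rw 2 [← h]
        simp only [← ρ.star_mul_self, mul_assoc]
    have hx' := hI hx
    simp only [I, TwoSidedIdeal.mem_mk', Set.mem_ofPred_eq] at hx'
    have hx_corner : φ x ∈ ρ.corner := by
      rw [← SetLike.mem_coe, ← hrange]
      exact ⟨x, rfl⟩
    obtain ⟨F, hF⟩ := ρ.exists_sum_eq_of_mem_corner hx_corner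
    choose y hy hφy using fun v w => hx' (ρ.pv (inl v)) (ρ.pv (inl w)) v w
    have hsum : x = ∑ v ∈ F, ∑ w ∈ F, y v w := by
      apply hinj
      rw [map_sum, ← hF]
      refine Finset.sum_congr rfl fun v _ => ?_
      rw [map_sum]
      refine Finset.sum_congr rfl fun w _ => ?_
      rw [hφy, ← mul_assoc, ← mul_assoc, ρ.pv_idem, mul_assoc _ (ρ.pv (inl w)), ρ.pv_idem]
    rw [hsum]
    exact sum_mem fun v _ => sum_mem fun w _ => hy v w
  · have hmap : ∀ {u}, StarSemigroup (σ.genSet K) u → StarSemigroup (ρ.genSet K) (φ u) := by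
      refine StarSemigroup.map φ (map_mul φ) (map_star φ) ?_
      rintro _ ⟨e, f, hef, rfl⟩
      rw [hφτ e f hef]
      exact (ρ.starSemigroup_ge e).mul_mem (ρ.starSemigroup_ge f).star_mem
    have h : J ≤ (tameIdeal (ρ.genSet K)).comap φ := tameIdeal_le fun u u' hu hu' => by
      rw [TwoSidedIdeal.mem_comap, map_projComm]
      exact projComm_mem_tameIdeal (hmap hu) (hmap hu')
    intro hx
    exact TwoSidedIdeal.mem_comap φ |>.1 (h hx)

end Representations

/-- **Statement 8.**  With `LV(E,C)` identified with the corner `V L(E,C) V` via `φ`,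
the ideal `J'` of `L(E,C)` generated by the commutators `[uu*, u'u'*]`, for `u,u'` in the
`*`-semigroup generated by `E¹`, intersects `V L(E,C) V` exactly in the ideal `J` of
`LV(E,C)` generated by the commutators `[uu*, u'u'*]` for `u,u'` in the `*`-semigroup
generated by the `τ(x,y)`; consequently the canonical surjection from
`LV^{ab}(E,C) = LV(E,C)/J` onto the corresponding corner of `L^{ab}(E,C) = L(E,C)/J'` is
a `*`-isomorphism. -/
theorem statement8 (G : BipSepGraph) (hs : Function.Surjective G.s)
    (hr : Function.Surjective G.r) (hlf : ∀ v : G.V1, {e | G.r e = v}.Finite)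
    (L : Type) [NonUnitalRing L] [Module K L] [SMulCommClass K L L] [IsScalarTower K L L]
    [StarRing L] [StarModule K L] (ρ : LPARep K G L) (hL : IsLPA K G L ρ)
    (LV : Type) [NonUnitalRing LV] [Module K LV] [SMulCommClass K LV LV]
    [IsScalarTower K LV LV] [StarRing LV] [StarModule K LV]
    (σ : LVRep K G LV) (hLV : IsLV K G LV σ)
    -- the identification of `LV(E,C)` with the corner `V L(E,C) V`:
    (φ : LV →⋆ₙₐ[K] L) (hinj : Function.Injective φ)
    (hrange : Set.range φ = (Submodule.span K
      {x : L | ∃ (u w : G.V0) (a : L), x = ρ.pv (Sum.inl u) * a * ρ.pv (Sum.inl w)} :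
        Submodule K L))
    (hφv : ∀ v : G.V0, φ (σ.pv v) = ρ.pv (Sum.inl v))
    (hφτ : ∀ e f, G.r e = G.r f → φ (σ.tau e f) = ρ.ge e * star (ρ.ge f))
    -- the abelianized algebras:
    (Lab : Type) [NonUnitalRing Lab] [Module K Lab] [SMulCommClass K Lab Lab]
    [IsScalarTower K Lab Lab] [StarRing Lab] [StarModule K Lab]
    (ρab : LPARep K G Lab) (hLab : IsLPAab K G Lab ρab)
    (LVab : Type) [NonUnitalRing LVab] [Module K LVab] [SMulCommClass K LVab LVab]
    [IsScalarTower K LVab LVab] [StarRing LVab] [StarModule K LVab]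
    (σab : LVRep K G LVab) (hLVab : IsLVab K G LVab σab) :
    letI J' : TwoSidedIdeal L := TwoSidedIdeal.span
      {z : L | ∃ u u', StarSemigroup (ρ.genSet K) u ∧ StarSemigroup (ρ.genSet K) u' ∧
        z = (u * star u) * (u' * star u') - (u' * star u') * (u * star u)}
    letI J : TwoSidedIdeal LV := TwoSidedIdeal.span
      {z : LV | ∃ u u', StarSemigroup (σ.genSet K) u ∧ StarSemigroup (σ.genSet K) u' ∧
        z = (u * star u) * (u' * star u') - (u' * star u') * (u * star u)}
    (∀ x : LV, φ x ∈ J' ↔ x ∈ J) ∧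
    -- consequently `LV^{ab}(E,C)` is `*`-isomorphic to the corner of `L^{ab}(E,C)`:
    (∃ ψ : LVab →⋆ₙₐ[K] Lab, Function.Injective ψ ∧
      Set.range ψ = (Submodule.span K
        {x : Lab | ∃ (u w : G.V0) (a : Lab),
          x = ρab.pv (Sum.inl u) * a * ρab.pv (Sum.inl w)} : Submodule K Lab) ∧
      (∀ v : G.V0, ψ (σab.pv v) = ρab.pv (Sum.inl v)) ∧
      (∀ e f, G.r e = G.r f → ψ (σab.tau e f) = ρab.ge e * star (ρab.ge f))) := by
  have hideal : ∀ x : LV, φ x ∈ tameIdeal (ρ.genSet K) ↔ x ∈ tameIdeal (σ.genSet K) :=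
    ρ.map_mem_tameIdeal_iff σ φ hinj hrange hφτ
  refine ⟨hideal, ?_⟩
  obtain ⟨f, hfv, hfe, hf, hf_zero⟩ := hL.exists_surjective_ker hLab
  obtain ⟨g, hgv, hge, hg, hg_zero⟩ := hLV.exists_surjective_ker hLVab fun c x hx => by
    rw [← hideal, map_smul]
    exact LPARep.smul_mem_tameIdeal c ((hideal x).2 hx)
  obtain ⟨ψ, ⟨hψv, hψτ⟩, -⟩ := hLVab.2 Lab ρab.toLVRep hLab.1.toLVRep
  have hcomp : ψ.comp g = f.comp φ := (hLV Lab ρab.toLVRep).unique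
    ⟨fun v => by simp [hgv, hψv], fun e e' h => by simp [hge e e' h, hψτ e e' h]⟩
    ⟨fun v => by simp [hφv, hfv, LPARep.toLVRep],
      fun e e' h => by simp [hφτ e e' h, hfe, map_star, LPARep.toLVRep]⟩
  have hcomp' : ∀ y, ψ (g y) = f (φ y) := DFunLike.congr_fun hcomp
  refine ⟨ψ, ?_, ?_, hψv, hψτ⟩
  · refine (injective_iff_map_eq_zero ψ).2 fun x hx => ?_
    obtain ⟨y, rfl⟩ := hg x
    rwa [hcomp', hf_zero, hideal, ← hg_zero] at hx
  · have hmap : ρab.corner = ρ.corner.map (f : L →ₗ[K] Lab) := by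
      rw [LPARep.corner, LPARep.corner, Submodule.map_span]
      congr 1
      ext x
      constructor
      · rintro ⟨u, w, a, rfl⟩
        obtain ⟨a, rfl⟩ := hf a
        exact ⟨_, ⟨u, w, a, rfl⟩, by simp [hfv]⟩
      · rintro ⟨_, ⟨u, w, a, rfl⟩, rfl⟩
        exact ⟨u, w, f a, by simp [hfv]⟩
    change _ = (ρab.corner : Set Lab)
    rw [hmap, Submodule.map_coe]
    change _ = f '' ρ.corner
    rw [LPARep.corner, ← hrange, ← Set.range_comp, ← hg.range_comp]
    exact congrArg Set.range (funext hcomp')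
end
end

section
/- Let 3≤m≤n be integers and let K be a field with involution. Then the Leavitt algebra L(m,n) has a maximal two-sided ideal 𝔪 such that the quotient L(m,n)/𝔪 is *-isomorphic to the tensor product algebra L(1,m−1) ⊗_K L(1,n−1). -/
open Sum

noncomputable section
open scoped Classical

variable (K : Type) [Field K] [StarRing K]
/-- A representation of the defining relations of the Leavitt algebra `L(m,n)`:
an `m × n` matrix `X = (x i j)` of elements of `A` with `X X* = Iₘ` and `X* X = Iₙ`. -/
structure LmnRep (K : Type) [Field K] [StarRing K] (m n : ℕ) (A : Type) [Ring A]
    [Algebra K A] [StarRing A] [StarModule K A] where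
  x : Fin m → Fin n → A
  row : ∀ i j : Fin m, ∑ k, x i k * star (x j k) = if i = j then 1 else 0
  col : ∀ i j : Fin n, ∑ k, star (x k i) * x k j = if i = j then 1 else 0

/-- `L` (with the representation `ρ`) *is* the Leavitt algebra `L(m,n)`: the universal
unital `*`-algebra over `K` on the entries of an `m × n` matrix `X` with `X X* = Iₘ`,
`X* X = Iₙ`. -/
def IsLmn (K : Type) [Field K] [StarRing K] (m n : ℕ) (L : Type) [Ring L] [Algebra K L]
    [StarRing L] [StarModule K L] (ρ : LmnRep K m n L) : Prop :=
  ∀ (A : Type) [Ring A] [Algebra K A] [StarRing A] [StarModule K A] (σ : LmnRep K m n A),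
    ∃! φ : L →⋆ₐ[K] A, ∀ i j, φ (ρ.x i j) = σ.x i j

/-- `T` (with the maps `ι₁, ι₂`) *is* the tensor product `A ⊗_K B` of the `*`-algebras
`A` and `B`: the images of `ι₁` and `ι₂` commute, and `(T, ι₁, ι₂)` is universal with
respect to pairs of `*`-homomorphisms with pointwise-commuting images
(so `a ⊗ b = ι₁(a) ι₂(b)`, with `(a ⊗ b)* = a* ⊗ b*`). -/
def IsStarTensorProduct (A B T : Type) [Ring A] [Algebra K A] [StarRing A] [StarModule K A]
    [Ring B] [Algebra K B] [StarRing B] [StarModule K B]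
    [Ring T] [Algebra K T] [StarRing T] [StarModule K T]
    (ι₁ : A →⋆ₐ[K] T) (ι₂ : B →⋆ₐ[K] T) : Prop :=
  (∀ a b, ι₁ a * ι₂ b = ι₂ b * ι₁ a) ∧
  ∀ (C : Type) [Ring C] [Algebra K C] [StarRing C] [StarModule K C]
    (f : A →⋆ₐ[K] C) (g : B →⋆ₐ[K] C), (∀ a b, f a * g b = g b * f a) →
    ∃! h : T →⋆ₐ[K] C, (∀ a, h (ι₁ a) = f a) ∧ (∀ b, h (ι₂ b) = g b)

/-- The product of the letters of a word `l` in a family `x`. -/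
def wordProd {R ι : Type} [Ring R] (x : ι → R) (l : List ι) : R := (l.map x).prod

section Words

variable {R ι κ : Type} [Ring R]

@[simp] lemma wordProd_nil (x : ι → R) : wordProd x [] = 1 := rfl

@[simp] lemma wordProd_cons (x : ι → R) (i : ι) (l : List ι) :
    wordProd x (i :: l) = x i * wordProd x l := by simp [wordProd]

@[simp] lemma wordProd_append (x : ι → R) (l l' : List ι) :
    wordProd x (l ++ l') = wordProd x l * wordProd x l' := by simp [wordProd]

lemma commute_wordProd {x : ι → R} {a : R} (h : ∀ i, Commute a (x i)) (l : List ι) :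
    Commute a (wordProd x l) := by
  induction l with
  | nil => exact Commute.one_right a
  | cons i l ih => simpa using (h i).mul_right ih

variable [StarRing R]

/-- The family `x` consists of isometries with orthogonal ranges adding up to the whole space. -/
structure IsCuntzFamily [Fintype ι] (x : ι → R) : Prop where
  star_mul_eq : ∀ i j, star (x i) * x j = if i = j then 1 else 0
  sum_mul_star : ∑ i, x i * star (x i) = 1

namespace IsCuntzFamily

variable [Fintype ι] [Fintype κ] {x : ι → R} {y : κ → R}

lemma star_wordProd_mul_self (hx : IsCuntzFamily x) (l : List ι) :
    star (wordProd x l) * wordProd x l = 1 := by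
  induction l with
  | nil => simp
  | cons i l ih =>
    rw [wordProd_cons, star_mul, mul_assoc, ← mul_assoc (star (x i)), hx.star_mul_eq]
    simpa using ih

lemma star_wordProd_mul_eq_zero (hx : IsCuntzFamily x) (l l' : List ι) (h : ¬ l <+: l')
    (h' : ¬ l' <+: l) : star (wordProd x l) * wordProd x l' = 0 := by
  induction l generalizing l' with
  | nil => simp at h
  | cons i l ih =>
    cases l' with
    | nil => simp at h'
    | cons j l' =>
      rw [wordProd_cons, wordProd_cons, star_mul, mul_assoc, ← mul_assoc (star (x i)),
        hx.star_mul_eq]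
      by_cases hij : i = j
      · subst hij
        simp only [List.cons_prefix_cons, true_and] at h h'
        simpa using ih l' h h'
      · simp [hij]

lemma star_mul_wordProd_mul (hx : IsCuntzFamily x) (i j : ι) (l : List ι) :
    star (x i) * (wordProd x l * x j) = 0 ∨
      ∃ r, star (x i) * (wordProd x l * x j) = wordProd x r := by
  cases l with
  | nil =>
    by_cases hij : i = j
    · exact Or.inr ⟨[], by simp [hx.star_mul_eq, hij]⟩
    · exact Or.inl (by simp [hx.star_mul_eq, hij])
  | cons h l =>
    rw [wordProd_cons, mul_assoc, ← mul_assoc, hx.star_mul_eq]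
    by_cases hij : i = h
    · exact Or.inr ⟨l ++ [j], by simp [hij]⟩
    · exact Or.inl (by simp [hij])

lemma exists_mul_wordProd_ne_zero (hx : IsCuntzFamily x) {z : R} (hz : z ≠ 0) (N : ℕ) :
    ∃ l : List ι, l.length = N ∧ z * wordProd x l ≠ 0 := by
  induction N generalizing z with
  | zero => exact ⟨[], rfl, by simpa using hz⟩
  | succ N ih =>
    obtain ⟨i, hi⟩ : ∃ i, z * x i ≠ 0 := by
      by_contra! h
      apply hz
      rw [← mul_one z, ← hx.sum_mul_star, Finset.mul_sum]
      simp [← mul_assoc, h]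
    obtain ⟨l, hl, hne⟩ := ih hi
    exact ⟨i :: l, by simp [hl], by simpa [mul_assoc] using hne⟩

end IsCuntzFamily

lemma eq_of_append_prefix_append {i₀ i₁ : ι} (hi : i₀ ≠ i₁) (N : ℕ) {l l' : List ι}
    (hl' : l'.length ≤ N)
    (h : l ++ (List.replicate N i₀ ++ [i₁]) <+: l' ++ (List.replicate N i₀ ++ [i₁])) :
    l = l' := by
  have hle : l.length ≤ l'.length := by simpa using h.length_le
  rcases hle.eq_or_lt with he | hlt
  · exact List.append_cancel_right (h.eq_of_length (by simp [he]))
  · obtain ⟨t, ht⟩ := h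
    have := congrArg (fun s => s[l.length + N]?) ht
    grind

lemma IsCuntzFamily.star_wordProd_mul_separator [Fintype ι] {x : ι → R} (hx : IsCuntzFamily x)
    {i₀ i₁ : ι} (hi : i₀ ≠ i₁) (N : ℕ) {l l' : List ι} (hl : l.length ≤ N)
    (hl' : l'.length ≤ N) :
    star (wordProd x (l ++ (List.replicate N i₀ ++ [i₁]))) *
      wordProd x (l' ++ (List.replicate N i₀ ++ [i₁])) = if l = l' then 1 else 0 := by
  split_ifs with h
  · rw [h, hx.star_wordProd_mul_self]
  · exact hx.star_wordProd_mul_eq_zero _ _ (fun hp => h (eq_of_append_prefix_append hi N hl' hp))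
      (fun hp => h (eq_of_append_prefix_append hi N hl hp).symm)

end Words

section Simplicity

variable {F T ι κ : Type} [Field F] [Ring T] [Algebra F T] {x : ι → T} {y : κ → T}

variable (F) in
/-- The span of the products of a word in `x` and a word in `y`. -/
def wordSpan (x : ι → T) (y : κ → T) : Submodule F T :=
  Submodule.span F (Set.range fun p : List ι × List κ => wordProd x p.1 * wordProd y p.2)

lemma wordProd_mul_mem_wordSpan (x : ι → T) (y : κ → T) (p : List ι) (q : List κ) :
    wordProd x p * wordProd y q ∈ wordSpan F x y :=
  Submodule.subset_span ⟨(p, q), rfl⟩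

lemma mul_mul_mem_wordSpan {a b : T}
    (h : ∀ p q, a * (wordProd x p * wordProd y q) * b ∈ wordSpan F x y) {z : T}
    (hz : z ∈ wordSpan F x y) : a * z * b ∈ wordSpan F x y := by
  induction hz using Submodule.span_induction with
  | mem z hz => obtain ⟨p, rfl⟩ := hz; exact h _ _
  | zero => simp
  | add u v _ _ hu hv => simpa [mul_add, add_mul] using add_mem hu hv
  | smul c u _ hu => simpa using Submodule.smul_mem _ c hu

variable (F) in
/-- The elements that are sent into `wordSpan F x y` by right multiplication with sufficiently
long words. -/
def eventuallyWordSpan (x : ι → T) (y : κ → T) : Submodule F T where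
  carrier := {z | ∃ N, ∀ p q, N ≤ p.length → N ≤ q.length →
    z * (wordProd x p * wordProd y q) ∈ wordSpan F x y}
  zero_mem' := ⟨0, by simp⟩
  add_mem' := by
    rintro u v ⟨M, hM⟩ ⟨N, hN⟩
    refine ⟨max M N, fun p q hp hq => ?_⟩
    rw [add_mul]
    exact add_mem (hM p q (by omega) (by omega)) (hN p q (by omega) (by omega))
  smul_mem' := by
    rintro c u ⟨M, hM⟩
    refine ⟨M, fun p q hp hq => ?_⟩
    rw [smul_mul_assoc]
    exact Submodule.smul_mem _ c (hM p q hp hq)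

lemma one_mem_eventuallyWordSpan : (1 : T) ∈ eventuallyWordSpan F x y :=
  ⟨0, fun p q _ _ => by simpa using wordProd_mul_mem_wordSpan x y p q⟩

lemma mul_left_mem_eventuallyWordSpan (i : ι) {z : T} (hz : z ∈ eventuallyWordSpan F x y) :
    x i * z ∈ eventuallyWordSpan F x y := by
  obtain ⟨N, hN⟩ := hz
  refine ⟨N, fun p q hp hq => ?_⟩
  have := mul_mul_mem_wordSpan (a := x i) (b := 1)
    (fun p q => by simpa [mul_assoc] using wordProd_mul_mem_wordSpan x y (i :: p) q) (hN p q hp hq)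
  simpa [mul_assoc] using this

lemma mul_right_mem_eventuallyWordSpan (hc : ∀ i j, Commute (x i) (y j)) (j : κ) {z : T}
    (hz : z ∈ eventuallyWordSpan F x y) : y j * z ∈ eventuallyWordSpan F x y := by
  obtain ⟨N, hN⟩ := hz
  refine ⟨N, fun p q hp hq => ?_⟩
  have := mul_mul_mem_wordSpan (a := y j) (b := 1) (fun p q => by
    have h := wordProd_mul_mem_wordSpan (F := F) x y p (j :: q)
    rwa [wordProd_cons, ← mul_assoc,
      ← (commute_wordProd (fun i => (hc i j).symm) p).eq, mul_assoc, ← mul_one (y j * _)] at h)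
    (hN p q hp hq)
  simpa [mul_assoc] using this

variable [StarRing T]

lemma star_left_mul_mem_eventuallyWordSpan [Fintype ι] (hx : IsCuntzFamily x)
    (hc : ∀ i j, Commute (x i) (y j)) (i : ι) {z : T}
    (hz : z ∈ eventuallyWordSpan F x y) : star (x i) * z ∈ eventuallyWordSpan F x y := by
  obtain ⟨N, hN⟩ := hz
  refine ⟨N + 1, fun p q hp hq => ?_⟩
  rcases List.eq_nil_or_concat p with rfl | ⟨p, j, rfl⟩
  · simp at hp
  have := mul_mul_mem_wordSpan (a := star (x i)) (b := x j) (fun r s => by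
    rw [mul_assoc, mul_assoc, ← (commute_wordProd (hc j) s).eq, ← mul_assoc (wordProd x r),
      ← mul_assoc]
    rcases hx.star_mul_wordProd_mul i j r with h | ⟨t, h⟩ <;> rw [h]
    · simp
    · exact wordProd_mul_mem_wordSpan x y t s) (hN p q (by simpa using hp) (by omega))
  rw [mul_assoc, mul_assoc, mul_assoc, ← (commute_wordProd (hc j) q).eq] at this
  simpa [mul_assoc] using this

lemma star_right_mul_mem_eventuallyWordSpan [Fintype κ] (hy : IsCuntzFamily y)
    (hc : ∀ i j, Commute (star (y j)) (x i)) (j : κ) {z : T}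
    (hz : z ∈ eventuallyWordSpan F x y) : star (y j) * z ∈ eventuallyWordSpan F x y := by
  obtain ⟨N, hN⟩ := hz
  refine ⟨N + 1, fun p q hp hq => ?_⟩
  rcases List.eq_nil_or_concat q with rfl | ⟨q, i, rfl⟩
  · simp at hq
  have := mul_mul_mem_wordSpan (a := star (y j)) (b := y i) (fun r s => by
    rw [← mul_assoc, (commute_wordProd (fun i => hc i j) r).eq, mul_assoc, mul_assoc]
    rcases hy.star_mul_wordProd_mul j i s with h | ⟨t, h⟩ <;> rw [h]
    · simp
    · exact wordProd_mul_mem_wordSpan x y r t) (hN p q (by omega) (by simpa using hq))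
  simpa [mul_assoc] using this

variable [Fintype ι] [Fintype κ]

lemma exists_mul_mul_eq_one_of_mem_wordSpan (hx : IsCuntzFamily x) (hy : IsCuntzFamily y)
    (hc : ∀ i j, Commute (x i) (y j))
    [Nontrivial ι] [Nontrivial κ] {z : T} (hz : z ∈ wordSpan F x y) (hne : z ≠ 0) :
    ∃ u v : T, u * z * v = 1 := by
  obtain ⟨c, rfl⟩ := (Finsupp.mem_span_range_iff_exists_finsupp).1 hz
  obtain ⟨p₀, hp₀⟩ : ∃ p, c p ≠ 0 := by
    by_contra! h
    exact hne (by simp [Finsupp.sum, h])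
  obtain ⟨i₀, i₁, hi⟩ := exists_pair_ne ι
  obtain ⟨j₀, j₁, hj⟩ := exists_pair_ne κ
  obtain ⟨N, hN⟩ : ∃ N, ∀ p ∈ c.support, p.1.length + p.2.length ≤ N :=
    ⟨c.support.sup fun p => p.1.length + p.2.length,
      fun p hp => Finset.le_sup (f := fun p => p.1.length + p.2.length) hp⟩
  set v := List.replicate N i₀ ++ [i₁]
  set w := List.replicate N j₀ ++ [j₁]
  have hcw : ∀ r s, Commute (wordProd x r) (wordProd y s) := fun r s =>
    commute_wordProd (fun j => (commute_wordProd (fun i => (hc i j).symm) r).symm) s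
  have hp₀N := hN p₀ (by simpa using hp₀)
  have key : ∀ p ∈ c.support,
      star (wordProd x (p₀.1 ++ v) * wordProd y (p₀.2 ++ w)) * (wordProd x p.1 * wordProd y p.2) *
        (wordProd x v * wordProd y w) = if p = p₀ then 1 else 0 := by
    intro p hp
    have hpN := hN p hp
    have e : (wordProd x p.1 * wordProd y p.2) * (wordProd x v * wordProd y w) =
        wordProd x (p.1 ++ v) * wordProd y (p.2 ++ w) := by
      rw [wordProd_append x p.1 v, wordProd_append y p.2 w]
      exact (hcw v p.2).symm.mul_mul_mul_comm _ _
    rw [mul_assoc, e, star_mul, mul_assoc, ← mul_assoc (star (wordProd x _)),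
      hx.star_wordProd_mul_separator hi N (by omega) (by omega)]
    by_cases h₁ : p₀.1 = p.1
    · rw [if_pos h₁, one_mul, hy.star_wordProd_mul_separator hj N (by omega) (by omega)]
      simp [Prod.ext_iff, h₁, eq_comm]
    · simp [Prod.ext_iff, h₁, Ne.symm h₁]
  refine ⟨(c p₀)⁻¹ • star (wordProd x (p₀.1 ++ v) * wordProd y (p₀.2 ++ w)),
    wordProd x v * wordProd y w, ?_⟩
  rw [Finsupp.sum, Finset.mul_sum, Finset.sum_mul,
    Finset.sum_congr rfl (g := fun p => if p = p₀ then (1 : T) else 0)]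
  · simp [hp₀]
  · intro p hp
    rw [mul_smul_comm, smul_mul_assoc, smul_mul_assoc, smul_mul_assoc, key p hp]
    split_ifs with h
    · rw [h, smul_smul, mul_inv_cancel₀ hp₀, one_smul]
    · simp

lemma exists_mul_mul_eq_one [StarRing F] [StarModule F T] (hx : IsCuntzFamily x) (hy : IsCuntzFamily y)
    (hc : ∀ i j, Commute (x i) (y j)) (hc' : ∀ i j, Commute (star (y j)) (x i))
    [Nontrivial ι] [Nontrivial κ]
    (hgen : StarAlgebra.adjoin F (Set.range x ∪ Set.range y) = ⊤)
    {z : T} (hne : z ≠ 0) : ∃ u v : T, u * z * v = 1 := by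
  have hstab : ∀ t : T, ∀ z ∈ eventuallyWordSpan F x y, t * z ∈ eventuallyWordSpan F x y := by
    intro t
    have ht : t ∈ (⊤ : StarSubalgebra F T).toSubalgebra := by simp
    rw [← hgen, StarAlgebra.adjoin_toSubalgebra] at ht
    induction ht using Algebra.adjoin_induction with
    | mem t ht =>
      intro z hz
      rcases ht with (⟨i, rfl⟩ | ⟨j, rfl⟩) | (⟨i, hi⟩ | ⟨j, hj⟩)
      · exact mul_left_mem_eventuallyWordSpan i hz
      · exact mul_right_mem_eventuallyWordSpan hc j hz
      · rw [← star_star t, ← hi]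
        exact star_left_mul_mem_eventuallyWordSpan hx hc i hz
      · rw [← star_star t, ← hj]
        exact star_right_mul_mem_eventuallyWordSpan hy hc' j hz
    | algebraMap r =>
      intro z hz
      rw [← Algebra.smul_def]
      exact Submodule.smul_mem _ r hz
    | add u v _ _ hu hv => intro z hz; rw [add_mul]; exact add_mem (hu z hz) (hv z hz)
    | mul u v _ _ hu hv => intro z hz; rw [mul_assoc]; exact hu _ (hv z hz)
  obtain ⟨N, hN⟩ : z ∈ eventuallyWordSpan F x y := by
    simpa using hstab z 1 one_mem_eventuallyWordSpan
  obtain ⟨p, hp, hzp⟩ := hx.exists_mul_wordProd_ne_zero hne N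
  obtain ⟨q, hq, hzq⟩ := hy.exists_mul_wordProd_ne_zero hzp N
  rw [mul_assoc] at hzq
  obtain ⟨u, v, huv⟩ := exists_mul_mul_eq_one_of_mem_wordSpan hx hy hc
    (hN p q hp.ge hq.ge) hzq
  exact ⟨u, wordProd x p * wordProd y q * v, by rw [← huv]; simp only [mul_assoc]⟩

end Simplicity

section Model

/-- The product of an algebra `R` with its opposite, with the scalars acting on the second factor
through the involution of `K`; exchanging the two factors makes it a `*`-algebra. -/
def StarDouble (R : Type) : Type := R × Rᵐᵒᵖ

namespace StarDouble

variable {R : Type} [Ring R] [Algebra K R]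

instance : Ring (StarDouble R) := inferInstanceAs (Ring (R × Rᵐᵒᵖ))

instance [Nontrivial R] : Nontrivial (StarDouble R) := inferInstanceAs (Nontrivial (R × Rᵐᵒᵖ))

instance : Algebra K (StarDouble R) :=
  RingHom.toAlgebra'
    (show K →+* R × Rᵐᵒᵖ from
      (algebraMap K R).prod ((algebraMap K Rᵐᵒᵖ).comp (starRingEnd K)))
    (fun c z => Prod.ext (Algebra.commutes c z.1) (Algebra.commutes (starRingEnd K c) z.2))

instance : StarRing (StarDouble R) where
  star z := (z.2.unop, MulOpposite.op z.1)
  star_involutive _ := rfl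
  star_mul _ _ := rfl
  star_add _ _ := rfl

instance : StarModule K (StarDouble R) where
  star_smul c z := by
    refine Prod.ext ?_ ?_
    · change (algebraMap K Rᵐᵒᵖ (star c) * z.2).unop = algebraMap K R (star c) * z.2.unop
      rw [MulOpposite.unop_mul]
      exact (Algebra.commutes (star c) z.2.unop).symm
    · change MulOpposite.op (algebraMap K R c * z.1) =
        algebraMap K Rᵐᵒᵖ (star (star c)) * MulOpposite.op z.1
      rw [star_star, Algebra.commutes, MulOpposite.op_mul]
      rfl

lemma mk_sum {ι : Type} (s : Finset ι) (f g : ι → R) :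
    (∑ i ∈ s, ((f i, MulOpposite.op (g i)) : StarDouble R)) =
      (∑ i ∈ s, f i, MulOpposite.op (∑ i ∈ s, g i)) := by
  refine Prod.ext ?_ ?_
  · exact Prod.fst_sum
  · exact Prod.snd_sum.trans (by simp)

end StarDouble

end Model

section Shift

variable (F : Type) [Field F]

/-- The operator on sequences that reads off the subsequence indexed by `i`. -/
def shiftDown {k : ℕ} (W : Type) [AddCommGroup W] [Module F W] (e : Fin k × ℕ ≃ ℕ) (i : Fin k) :
    Module.End F (ℕ → W) :=
  LinearMap.funLeft F W fun n => e (i, n)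

/-- The operator on sequences that spreads a sequence over the subsequence indexed by `i`. -/
def shiftUp {k : ℕ} (W : Type) [AddCommGroup W] [Module F W] (e : Fin k × ℕ ≃ ℕ) (i : Fin k) :
    Module.End F (ℕ → W) where
  toFun f n := if (e.symm n).1 = i then f (e.symm n).2 else 0
  map_add' f g := by ext n; by_cases h : (e.symm n).1 = i <;> simp [h]
  map_smul' c f := by ext n; by_cases h : (e.symm n).1 = i <;> simp [h]

variable {k : ℕ} (W : Type) [AddCommGroup W] [Module F W] (e : Fin k × ℕ ≃ ℕ)

lemma shiftDown_mul_shiftUp (i j : Fin k) :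
    shiftDown F W e i * shiftUp F W e j = if i = j then 1 else 0 := by
  ext f n
  by_cases h : i = j <;> simp [shiftDown, shiftUp, LinearMap.funLeft_apply, h]

lemma sum_shiftUp_mul_shiftDown : ∑ i, shiftUp F W e i * shiftDown F W e i = 1 := by
  ext f n
  simp [shiftDown, shiftUp, LinearMap.funLeft_apply, LinearMap.sum_apply]

lemma compLeft_mul_shiftUp (D : Module.End F W) (i : Fin k) :
    D.compLeft ℕ * shiftUp F W e i = shiftUp F W e i * D.compLeft ℕ := by
  refine LinearMap.ext fun f => funext fun n => ?_
  by_cases h : (e.symm n).1 = i <;> simp [shiftUp, h]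

end Shift

section Representations

/-- Families `u`, `d` with `d i * u j = δ i j` and `∑ u i * d i = 1` in an algebra `R` give a
representation of the relations of `L(1,k)` in `StarDouble R`. -/
def StarDouble.rep {R : Type} [Ring R] [Algebra K R] {k : ℕ} (u d : Fin k → R)
    (hdu : ∀ i j, d i * u j = if i = j then 1 else 0) (hud : ∑ i, u i * d i = 1) :
    LmnRep K 1 k (StarDouble R) where
  x _ j := (u j, MulOpposite.op (d j))
  row i j := by
    rw [Subsingleton.elim i j, if_pos rfl]
    refine (StarDouble.mk_sum Finset.univ (fun i => u i * d i) (fun i => u i * d i)).trans ?_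
    rw [hud]
    rfl
  col i j := by
    rw [Fin.sum_univ_one]
    change (d i * u j, MulOpposite.op (d j * u i)) = _
    rw [hdu, hdu]
    by_cases h : i = j
    · simp only [h, if_true]; rfl
    · simp only [h, Ne.symm h, if_false]; rfl

variable {K}

lemma LmnRep.isCuntzFamily {k : ℕ} {A C : Type} [Ring A] [Algebra K A] [StarRing A]
    [StarModule K A] [Ring C] [Algebra K C] [StarRing C] [StarModule K C]
    (σ : LmnRep K 1 k A) (f : A →⋆ₐ[K] C) : IsCuntzFamily fun i => f (σ.x 0 i) where
  star_mul_eq i j := by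
    have := congrArg f (σ.col i j)
    rw [Fin.sum_univ_one] at this
    rw [← map_star, ← map_mul, this]
    split_ifs <;> simp
  sum_mul_star := by
    have := congrArg f (σ.row 0 0)
    simpa [map_star] using this

lemma IsLmn.mem_of_forall_mem {m n : ℕ} {L : Type} [Ring L] [Algebra K L] [StarRing L]
    [StarModule K L] {ρ : LmnRep K m n L} (hL : IsLmn K m n L ρ) (S : StarSubalgebra K L)
    (hS : ∀ i j, ρ.x i j ∈ S) (z : L) : z ∈ S := by
  obtain ⟨φ, hφ, -⟩ := hL S
    { x := fun i j => ⟨ρ.x i j, hS i j⟩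
      row := fun i j => Subtype.ext (by
        have := ρ.row i j
        split_ifs at this ⊢ <;> simpa using this)
      col := fun i j => Subtype.ext (by
        have := ρ.col i j
        split_ifs at this ⊢ <;> simpa using this) }
  have : S.subtype.comp φ = StarAlgHom.id K L :=
    (hL L ρ).unique (fun i j => by simp [hφ]) (fun i j => rfl)
  have hz : (φ z : L) = z := DFunLike.congr_fun this z
  exact hz ▸ (φ z).2

lemma IsStarTensorProduct.mem_of_forall_mem {A B T : Type} [Ring A] [Algebra K A] [StarRing A]
    [StarModule K A] [Ring B] [Algebra K B] [StarRing B] [StarModule K B]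
    [Ring T] [Algebra K T] [StarRing T] [StarModule K T]
    {ι₁ : A →⋆ₐ[K] T} {ι₂ : B →⋆ₐ[K] T} (hT : IsStarTensorProduct K A B T ι₁ ι₂)
    (S : StarSubalgebra K T) (h₁ : ∀ a, ι₁ a ∈ S) (h₂ : ∀ b, ι₂ b ∈ S) (z : T) : z ∈ S := by
  obtain ⟨φ, ⟨hφ₁, hφ₂⟩, -⟩ := hT.2 S (ι₁.codRestrict S h₁) (ι₂.codRestrict S h₂)
    (fun a b => Subtype.ext (hT.1 a b))
  have : S.subtype.comp φ = StarAlgHom.id K T :=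
    (hT.2 T ι₁ ι₂ hT.1).unique ⟨fun a => by simp [hφ₁], fun b => by simp [hφ₂]⟩
      ⟨fun a => rfl, fun b => rfl⟩
  have hz : (φ z : T) = z := DFunLike.congr_fun this z
  exact hz ▸ (φ z).2

lemma IsLmn.commute_of_forall_commute {m n p q : ℕ} {A B C : Type} [Ring A] [Algebra K A]
    [StarRing A] [StarModule K A] [Ring B] [Algebra K B] [StarRing B] [StarModule K B]
    [Ring C] [Algebra K C] [StarRing C] [StarModule K C]
    {α : LmnRep K m n A} (hA : IsLmn K m n A α) {β : LmnRep K p q B} (hB : IsLmn K p q B β)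
    (f : A →⋆ₐ[K] C) (g : B →⋆ₐ[K] C)
    (h : ∀ i j r s, g (β.x r s) * f (α.x i j) = f (α.x i j) * g (β.x r s))
    (h' : ∀ i j r s, star (g (β.x r s)) * f (α.x i j) = f (α.x i j) * star (g (β.x r s)))
    (a : A) (b : B) : f a * g b = g b * f a := by
  have hf : ∀ a r s, f a ∈ StarSubalgebra.centralizer K {g (β.x r s)} := fun a r s =>
    hA.mem_of_forall_mem ((StarSubalgebra.centralizer K {g (β.x r s)}).comap f)
      (fun i j => by
        simp only [StarSubalgebra.mem_comap, StarSubalgebra.mem_centralizer_iff,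
          Set.mem_singleton_iff, forall_eq]
        exact ⟨h i j r s, h' i j r s⟩) a
  have hg : g b ∈ StarSubalgebra.centralizer K (Set.range f) :=
    hB.mem_of_forall_mem ((StarSubalgebra.centralizer K (Set.range f)).comap g)
      (fun r s => by
        simp only [StarSubalgebra.mem_comap, StarSubalgebra.mem_centralizer_iff,
          Set.forall_mem_range]
        intro a
        simp only [StarSubalgebra.mem_centralizer_iff, Set.mem_singleton_iff, forall_eq] at hf
        exact ⟨(hf a r s).1.symm, by simpa [map_star] using (hf (star a) r s).1.symm⟩) b
  exact ((StarSubalgebra.mem_centralizer_iff K).1 hg _ ⟨a, rfl⟩).1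

lemma IsStarTensorProduct.nontrivial {k l : ℕ} (hk : 1 ≤ k) (hl : 1 ≤ l)
    {A B T : Type} [Ring A] [Algebra K A] [StarRing A]
    [StarModule K A] [Ring B] [Algebra K B] [StarRing B] [StarModule K B]
    [Ring T] [Algebra K T] [StarRing T] [StarModule K T]
    {α : LmnRep K 1 k A} (hA : IsLmn K 1 k A α) {β : LmnRep K 1 l B} (hB : IsLmn K 1 l B β)
    {ι₁ : A →⋆ₐ[K] T} {ι₂ : B →⋆ₐ[K] T} (hT : IsStarTensorProduct K A B T ι₁ ι₂) :
    Nontrivial T := by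
  have : NeZero k := ⟨by omega⟩
  have : NeZero l := ⟨by omega⟩
  obtain ⟨e⟩ : Nonempty (Fin k × ℕ ≃ ℕ) := nonempty_equiv_of_countable
  obtain ⟨e'⟩ : Nonempty (Fin l × ℕ ≃ ℕ) := nonempty_equiv_of_countable
  let u : Fin k → Module.End K (ℕ → ℕ → K) := shiftUp K (ℕ → K) e
  let d : Fin k → Module.End K (ℕ → ℕ → K) := shiftDown K (ℕ → K) e
  let u' : Fin l → Module.End K (ℕ → ℕ → K) := fun j => (shiftUp K K e' j).compLeft ℕ
  let d' : Fin l → Module.End K (ℕ → ℕ → K) := fun j => (shiftDown K K e' j).compLeft ℕ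
  have hd'u' : ∀ i j, d' i * u' j = if i = j then 1 else 0 := by
    intro i j
    have := shiftDown_mul_shiftUp K K e' i j
    refine LinearMap.ext fun f => funext fun n => (LinearMap.congr_fun this (f n)).trans ?_
    split_ifs <;> rfl
  have hu'd' : ∑ j, u' j * d' j = 1 := by
    refine LinearMap.ext fun f => funext fun n =>
      Eq.trans ?_ (LinearMap.congr_fun (sum_shiftUp_mul_shiftDown K K e') (f n))
    simp [u', d', LinearMap.sum_apply]
  have huu' : ∀ i j, u' j * u i = u i * u' j := fun i j => compLeft_mul_shiftUp K _ e _ i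
  have hud' : ∀ i j, d' j * u i = u i * d' j := fun i j => compLeft_mul_shiftUp K _ e _ i
  have hdu' : ∀ i j, u' j * d i = d i * u' j := fun i j => rfl
  have hdd' : ∀ i j, d' j * d i = d i * d' j := fun i j => rfl
  obtain ⟨f, hf, -⟩ := hA _ (StarDouble.rep K u d (shiftDown_mul_shiftUp K _ e)
    (sum_shiftUp_mul_shiftDown K _ e))
  obtain ⟨g, hg, -⟩ := hB _ (StarDouble.rep K u' d' hd'u' hu'd')
  obtain ⟨φ, -⟩ := hT.2 _ f g (hA.commute_of_forall_commute hB f g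
    (fun i j r s => by
      rw [hf, hg]
      exact Prod.ext (huu' j s) (congrArg MulOpposite.op (hdd' j s).symm))
    (fun i j r s => by
      rw [hf, hg]
      exact Prod.ext (hud' j s) (congrArg MulOpposite.op (hdu' j s).symm)))
  exact φ.toAlgHom.toRingHom.domain_nontrivial

/-- The block matrix with blocks the adjoint of a row `a` and a row `b` represents the relations
of `L(k+1,l+1)`. -/
def IsCuntzFamily.lmnRep {T : Type} [Ring T] [Algebra K T] [StarRing T] [StarModule K T]
    {k l : ℕ} {a : Fin k → T} {b : Fin l → T} (ha : IsCuntzFamily a) (hb : IsCuntzFamily b) :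
    LmnRep K (k + 1) (l + 1) T where
  x i j := Fin.cases (Fin.cases 0 b j)
    (fun i => Fin.cases (motive := fun _ => T) (star (a i)) (fun _ => 0) j) i
  row i j := by
    cases i using Fin.cases <;> cases j using Fin.cases <;>
      simp [Fin.sum_univ_succ, ha.star_mul_eq, hb.sum_mul_star, Fin.succ_ne_zero,
        (Fin.succ_ne_zero _).symm]
  col i j := by
    cases i using Fin.cases <;> cases j using Fin.cases <;>
      simp [Fin.sum_univ_succ, ha.sum_mul_star, hb.star_mul_eq, Fin.succ_ne_zero,
        (Fin.succ_ne_zero _).symm]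

lemma isCoatom_ker_of_surjective {L T : Type} [Ring L] [Ring T] [Nontrivial T] (ψ : L →+* T)
    (hψ : Function.Surjective ψ) (hT : ∀ z : T, z ≠ 0 → ∃ u v, u * z * v = 1) :
    IsCoatom (TwoSidedIdeal.ker ψ) := by
  refine ⟨fun h => ?_, fun J hJ => ?_⟩
  · have : (1 : L) ∈ TwoSidedIdeal.ker ψ := h ▸ trivial
    simp [TwoSidedIdeal.mem_ker] at this
  · obtain ⟨hle, z, hzJ, hz⟩ := SetLike.lt_iff_le_and_exists.1 hJ
    rw [TwoSidedIdeal.mem_ker] at hz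
    obtain ⟨u, v, huv⟩ := hT _ hz
    obtain ⟨u, rfl⟩ := hψ u
    obtain ⟨v, rfl⟩ := hψ v
    have h₁ : u * z * v ∈ J := J.mul_mem_right _ _ (J.mul_mem_left _ _ hzJ)
    have h₂ : u * z * v - 1 ∈ J := hle (by simp [TwoSidedIdeal.mem_ker, huv])
    rw [← TwoSidedIdeal.one_mem_iff]
    simpa using J.sub_mem h₁ h₂

theorem exists_isCoatom_ker_eq {k l : ℕ} (hk : 2 ≤ k) (hl : 2 ≤ l)
    {L : Type} [Ring L] [Algebra K L] [StarRing L] [StarModule K L]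
    {ρ : LmnRep K (k + 1) (l + 1) L} (hL : IsLmn K (k + 1) (l + 1) L ρ)
    {A : Type} [Ring A] [Algebra K A] [StarRing A] [StarModule K A]
    {α : LmnRep K 1 k A} (hA : IsLmn K 1 k A α)
    {B : Type} [Ring B] [Algebra K B] [StarRing B] [StarModule K B]
    {β : LmnRep K 1 l B} (hB : IsLmn K 1 l B β)
    {T : Type} [Ring T] [Algebra K T] [StarRing T] [StarModule K T]
    {ι₁ : A →⋆ₐ[K] T} {ι₂ : B →⋆ₐ[K] T} (hT : IsStarTensorProduct K A B T ι₁ ι₂) :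
    ∃ 𝔪 : TwoSidedIdeal L, IsCoatom 𝔪 ∧
      ∃ ψ : L →⋆ₐ[K] T, Function.Surjective ψ ∧ ∀ z : L, ψ z = 0 ↔ z ∈ 𝔪 := by
  have := hT.nontrivial (by omega) (by omega) hA hB
  have : Nontrivial (Fin k) := Fin.nontrivial_iff_two_le.2 hk
  have : Nontrivial (Fin l) := Fin.nontrivial_iff_two_le.2 hl
  have ha := α.isCuntzFamily ι₁
  have hb := β.isCuntzFamily ι₂
  have hgen : ∀ S : StarSubalgebra K T, (∀ i, ι₁ (α.x 0 i) ∈ S) → (∀ j, ι₂ (β.x 0 j) ∈ S) →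
      ∀ z, z ∈ S := fun S h₁ h₂ => hT.mem_of_forall_mem S
    (hA.mem_of_forall_mem (S.comap ι₁) fun i j => Subsingleton.elim 0 i ▸ h₁ j)
    (hB.mem_of_forall_mem (S.comap ι₂) fun i j => Subsingleton.elim 0 i ▸ h₂ j)
  obtain ⟨ψ, hψ, -⟩ := hL T (ha.lmnRep hb)
  have hsurj : Function.Surjective ψ := hgen ψ.range
    (fun i => by
      rw [← star_star (ι₁ _)]
      exact star_mem (⟨ρ.x i.succ 0, hψ i.succ 0⟩ : _ ∈ ψ.range))
    (fun j => ⟨ρ.x 0 j.succ, hψ 0 j.succ⟩)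
  have hsimple : ∀ z : T, z ≠ 0 → ∃ u v, u * z * v = 1 := fun z hz =>
    exists_mul_mul_eq_one (F := K) ha hb (fun i j => hT.1 _ _)
      (fun i j => by
        rw [← map_star]
        exact (hT.1 _ _).symm)
      (eq_top_iff.2 fun z _ => hgen _
        (fun i => StarAlgebra.subset_adjoin K _ (Or.inl ⟨i, rfl⟩))
        (fun j => StarAlgebra.subset_adjoin K _ (Or.inr ⟨j, rfl⟩)) z) hz
  exact ⟨TwoSidedIdeal.ker ψ, isCoatom_ker_of_surjective (ψ : L →+* T) hsurj hsimple, ψ, hsurj,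
    fun z => (TwoSidedIdeal.mem_ker ψ).symm⟩

end Representations

/-- **Statement 16.** For `3 ≤ m ≤ n`, the Leavitt algebra `L(m,n)` has a maximal
two-sided ideal `𝔪` such that `L(m,n)/𝔪` is `*`-isomorphic to the tensor product
`L(1,m−1) ⊗_K L(1,n−1)`.  (The quotient being `*`-isomorphic to `T` is expressed by a
surjective `*`-homomorphism `ψ : L(m,n) → T` whose kernel is exactly `𝔪`.) -/
theorem statement16 (m n : ℕ) (hm : 3 ≤ m) (hmn : m ≤ n)
    (L : Type) [Ring L] [Algebra K L] [StarRing L] [StarModule K L]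
    (ρ : LmnRep K m n L) (hL : IsLmn K m n L ρ)
    (A : Type) [Ring A] [Algebra K A] [StarRing A] [StarModule K A]
    (α : LmnRep K 1 (m - 1) A) (hA : IsLmn K 1 (m - 1) A α)
    (B : Type) [Ring B] [Algebra K B] [StarRing B] [StarModule K B]
    (β : LmnRep K 1 (n - 1) B) (hB : IsLmn K 1 (n - 1) B β)
    (T : Type) [Ring T] [Algebra K T] [StarRing T] [StarModule K T]
    (ι₁ : A →⋆ₐ[K] T) (ι₂ : B →⋆ₐ[K] T) (hT : IsStarTensorProduct K A B T ι₁ ι₂) :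
    ∃ 𝔪 : TwoSidedIdeal L, IsCoatom 𝔪 ∧
      ∃ ψ : L →⋆ₐ[K] T, Function.Surjective ψ ∧ ∀ z : L, ψ z = 0 ↔ z ∈ 𝔪 := by
  obtain ⟨k, rfl⟩ := Nat.exists_eq_add_of_le' (show 1 ≤ m by omega)
  obtain ⟨l, rfl⟩ := Nat.exists_eq_add_of_le' (show 1 ≤ n by omega)
  exact exists_isCoatom_ker_eq (by omega) (by omega) hL hA hB hT
end
end
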